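/- Suppose T : Ω → closure(Ω) satisfies hypotheses (H0)–(H5), let L be the transfer operator of T, set Γ_ε := ∪_k ∂^ε Ω_k, and assume there exist C > 0 and α ∈ (0,1] such that m(Γ_ε) ≤ C^d ε^α for every ε > 0. Let a ≥ 1, let ν₀ := ‖(DT)^{-1}‖_{L∞} (so ν₀ ≤ λ^{-1} < 1), fix ν ∈ (ν₀^{1/a}, 1), and for ε > 0, n ∈ ℕ define L_{ε,n} f := L((1 − 1_{Γ_{ε ν^n}}) f) and L̃_{ε,n} := L_{ε,0} ∘ L_{ε,1} ∘ ⋯ ∘ L_{ε,n−1} (with L̃_{ε,0} = Id). Then there exists a constant C' > 0, depending only on T and the constants in the hypotheses, such that for every f ∈ BV(Ω) with f ≥ 0, every ε > 0 and every n ∈ ℕ, ‖L^n f − L̃_{ε,n} f‖_{L¹(Ω,m)} ≤ C' ε^{α/d} (1 − ν^{α/d})^{-1} ‖f‖_{BV(Ω)}. -/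

import Mathlib

open MeasureTheory Set Filter Topology
open scoped ENNReal NNReal Classical

noncomputable section

namespace Liverani

/-- The divergence of a vector field on `ℝ^d`. -/
def divg {d : ℕ} (φ : (Fin d → ℝ) → (Fin d → ℝ)) (x : Fin d → ℝ) : ℝ :=
  ∑ j, fderiv ℝ φ x (Pi.single j 1) j

/-- Test vector fields: `C¹`, compactly supported, sup-norm `≤ 1`. -/
def IsTest (d : ℕ) (φ : (Fin d → ℝ) → (Fin d → ℝ)) : Prop :=
  ContDiff ℝ 1 φ ∧ HasCompactSupport φ ∧ ∀ x, ‖φ x‖ ≤ 1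

/-- The BV seminorm on `ℝ^d`, extended-real valued. -/
def bvNormE {d : ℕ} (h : (Fin d → ℝ) → ℝ) : ℝ≥0∞ :=
  ⨆ φ : {φ : (Fin d → ℝ) → (Fin d → ℝ) // IsTest d φ},
    ENNReal.ofReal (∫ x, h x * divg φ.1 x)

/-- The BV seminorm, real valued. -/
def bvNorm {d : ℕ} (h : (Fin d → ℝ) → ℝ) : ℝ := (bvNormE h).toReal

/-- Membership in `BV(ℝ^d)`. -/
def MemBV {d : ℕ} (h : (Fin d → ℝ) → ℝ) : Prop :=
  Integrable h volume ∧ bvNormE h < ⊤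

/-- The BV seminorm on a set `Ω` (of the extension of `h` by zero), extended-real valued. -/
def bvNormOnE {d : ℕ} (Ω : Set (Fin d → ℝ)) (h : (Fin d → ℝ) → ℝ) : ℝ≥0∞ :=
  bvNormE (Ω.indicator h)

/-- The BV norm on a set `Ω`. -/
def bvNormOn {d : ℕ} (Ω : Set (Fin d → ℝ)) (h : (Fin d → ℝ) → ℝ) : ℝ :=
  bvNorm (Ω.indicator h)

/-- Membership in `BV(Ω)`: the extension by zero belongs to `BV(ℝ^d)`. -/
def MemBVOn {d : ℕ} (Ω : Set (Fin d → ℝ)) (h : (Fin d → ℝ) → ℝ) : Prop :=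
  MemBV (Ω.indicator h)

/-- One-dimensional BV seminorm (for slices). -/
def bvNorm1E (g : ℝ → ℝ) : ℝ≥0∞ :=
  ⨆ φ : {φ : ℝ → ℝ // ContDiff ℝ 1 φ ∧ HasCompactSupport φ ∧ ∀ y, |φ y| ≤ 1},
    ENNReal.ofReal (∫ y, g y * deriv φ.1 y)

/-- The matrix norm `‖A‖_∞ = max_i Σ_j |A i j|`. -/
def matNorm {d : ℕ} (A : Matrix (Fin d) (Fin d) ℝ) : ℝ :=
  NNReal.toReal (Finset.univ.sup fun i => ∑ j, ‖A i j‖₊)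

/-- The Jacobian matrix `DT` of a map `T` computed via `fderiv`. -/
def jac {d : ℕ} (T : (Fin d → ℝ) → (Fin d → ℝ)) (x : Fin d → ℝ) :
    Matrix (Fin d) (Fin d) ℝ :=
  Matrix.of fun i j => fderiv ℝ T x (Pi.single j 1) i

/-- The inverse Jacobian matrix `(DT)⁻¹`. -/
def jacInv {d : ℕ} (T : (Fin d → ℝ) → (Fin d → ℝ)) (x : Fin d → ℝ) :
    Matrix (Fin d) (Fin d) ℝ :=
  (jac T x)⁻¹

/-- Entrywise partial derivative `∂_{x_j} (DT)⁻¹` of the inverse Jacobian along the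
`j`-th coordinate. -/
def jacDj {d : ℕ} (T : (Fin d → ℝ) → (Fin d → ℝ)) (j : Fin d) (z : Fin d → ℝ) :
    Matrix (Fin d) (Fin d) ℝ :=
  Matrix.of fun i i' => deriv (fun y => jacInv T (Function.update z j y) i i') (z j)

/-- The transfer operator `(L h)(x) = Σ_{y ∈ Ω ∩ T⁻¹{x}} |det D_y T|⁻¹ h(y)`. -/
def transferOp {d : ℕ} (Ω : Set (Fin d → ℝ)) (T : (Fin d → ℝ) → (Fin d → ℝ))
    (h : (Fin d → ℝ) → ℝ) (x : Fin d → ℝ) : ℝ :=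
  ∑' y : ↥(Ω ∩ T ⁻¹' {x}), |(jac T y).det|⁻¹ * h y

/-- `Ω_k^ε`, the part of `U` at distance at least `ε` from its boundary. -/
def innerPart {d : ℕ} (U : Set (Fin d → ℝ)) (ε : ℝ) : Set (Fin d → ℝ) :=
  {x ∈ U | ε ≤ Metric.infDist x (frontier U)}

/-- `∂^ε Ω_k`, the `ε`-boundary layer of `U`. -/
def bLayer {d : ℕ} (U : Set (Fin d → ℝ)) (ε : ℝ) : Set (Fin d → ℝ) :=
  U \ innerPart U ε

/-- `Γ_ε = ∪_k ∂^ε Ω_k`. -/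
def Gam {d : ℕ} (parts : ℕ → Set (Fin d → ℝ)) (ε : ℝ) : Set (Fin d → ℝ) :=
  ⋃ k, bLayer (parts k) ε

/-- A piecewise expanding system: the data `Ω, T, {Ω_k}, {I_{k,ℓ}}, δ, λ` together with
hypotheses (H0)–(H5). -/
structure PES (d : ℕ) where
  Ω : Set (Fin d → ℝ)
  T : (Fin d → ℝ) → (Fin d → ℝ)
  parts : ℕ → Set (Fin d → ℝ)
  Ifam : Fin d → (Fin d → ℝ) → ℕ → ℕ → Set ℝ
  δ : ℝ
  lam : ℝ
  Ω_open : IsOpen Ω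
  Ω_subset : Ω ⊆ Set.Icc 0 1
  T_maps : Set.MapsTo T Ω (closure Ω)
  /-- (H0) -/
  h0 : ∀ n : ℕ, volume (T^[n] ⁻¹' frontier Ω) = 0
  /-- (H1) -/
  parts_open : ∀ k, IsOpen (parts k)
  parts_conn : ∀ k, IsPreconnected (parts k)
  parts_disj : Pairwise (Function.onFun Disjoint parts)
  parts_union : ⋃ k, parts k = Ω
  T_C2 : ∀ k, ContDiffOn ℝ 2 T (parts k)
  T_inv : ∀ k, ∃ S : (Fin d → ℝ) → (Fin d → ℝ),
    ContDiffOn ℝ 1 S (T '' parts k) ∧ ∀ x ∈ parts k, S (T x) = x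
  /-- (H2): continuous extension of `T` to the closure of each `Ω_k` -/
  h2T : ∀ k, ∃ g : (Fin d → ℝ) → (Fin d → ℝ),
    ContinuousOn g (closure (parts k)) ∧ Set.EqOn g T (parts k)
  /-- (H2): continuous extension of `(DT)⁻¹` to the closure of each `Ω_k` -/
  h2D : ∀ k, ∃ G : (Fin d → ℝ) → Matrix (Fin d) (Fin d) ℝ,
    ContinuousOn G (closure (parts k)) ∧ Set.EqOn G (jacInv T) (parts k)
  /-- (H3): the slice structure -/
  δ_pos : 0 < δ
  lam_gt_one : 1 < lam
  Ifam_indep : ∀ (j : Fin d) (x x' : Fin d → ℝ) (k ℓ : ℕ),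
    (∀ i, i ≠ j → x i = x' i) → Ifam j x k ℓ = Ifam j x' k ℓ
  Ifam_open : ∀ j x k ℓ, IsOpen (Ifam j x k ℓ)
  Ifam_conn : ∀ j x k ℓ, IsPreconnected (Ifam j x k ℓ)
  Ifam_disj : ∀ j x k, Pairwise (Function.onFun Disjoint (Ifam j x k))
  Ifam_union : ∀ j x k, {y : ℝ | Function.update x j y ∈ parts k} = ⋃ ℓ, Ifam j x k ℓ
  h3 : ∀ x ∈ Set.Icc (0 : Fin d → ℝ) 1, ∀ j : Fin d,
    (∑' p : ℕ × ℕ,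
      if (Set.Icc (x j - δ) (x j + δ) ∩ Ifam j x p.1 p.2).Nonempty then
        ⨆ y ∈ Ifam j x p.1 p.2,
          ENNReal.ofReal (matNorm (jacInv T (Function.update x j y)))
      else 0) ≤ ENNReal.ofReal lam⁻¹
  /-- (H4) -/
  h4 : ∀ j : Fin d,
    Filter.Tendsto (fun ε : ℝ =>
      ⨆ x : Fin d → ℝ, ∑' k : ℕ, ∫⁻ y in Set.Icc (0:ℝ) 1,
        Set.indicator (bLayer (parts k) ε)
          (fun z => ENNReal.ofReal (matNorm (jacDj T j z)))
          (Function.update x j y))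
      (nhdsWithin 0 (Set.Ioi 0)) (nhds 0)
  /-- (H5) -/
  h5 : ∀ i j k : Fin d,
    MeasureTheory.IntegrableOn (fun x => jac T x k j * jacInv T x j i) Ω volume

/-- A piecewise expanding system satisfying in addition hypothesis (H6). -/
structure PES6 (d : ℕ) extends PES d where
  Cb : ℝ
  αb : ℝ
  ab : ℝ
  Cb_pos : 0 < Cb
  αb_mem : αb ∈ Set.Ioc (0:ℝ) 1
  ab_ge_one : 1 ≤ ab
  /-- (H6): measure of the boundary layers -/
  h6a : ∀ ε : ℝ, 0 < ε →
    volume (⋃ k, bLayer (parts k) ε) ≤ ENNReal.ofReal (Cb ^ d * ε ^ αb)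
  /-- (H6): blow-up of `∇ det DT` near the singularities -/
  h6b : ∀ x ∈ Ω, ∀ i : Fin d,
    |fderiv ℝ (fun z => (jac T z).det) x (Pi.single i 1)| ≤
      Cb * Metric.infDist x (frontier Ω) ^ (-ab)

/-- `μ` is a `T`-invariant probability measure, absolutely continuous w.r.t. Lebesgue,
supported in `Ω`. -/
def InvariantMeasure {d : ℕ} (Ω : Set (Fin d → ℝ)) (T : (Fin d → ℝ) → (Fin d → ℝ))
    (μ : Measure (Fin d → ℝ)) : Prop :=
  IsProbabilityMeasure μ ∧ μ ≪ volume ∧ μ Ωᶜ = 0 ∧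
    ∀ A : Set (Fin d → ℝ), MeasurableSet A → μ (T ⁻¹' A) = μ A

/-- `μ` is an ergodic absolutely continuous invariant probability measure. -/
def ErgodicACIM {d : ℕ} (Ω : Set (Fin d → ℝ)) (T : (Fin d → ℝ) → (Fin d → ℝ))
    (μ : Measure (Fin d → ℝ)) : Prop :=
  InvariantMeasure Ω T μ ∧
    ∀ A : Set (Fin d → ℝ), MeasurableSet A → T ⁻¹' A = A → μ A = 0 ∨ μ A = 1

/-- `h` is a density of `μ` with respect to Lebesgue measure. -/
def IsDensity {d : ℕ} (μ : Measure (Fin d → ℝ)) (h : (Fin d → ℝ) → ℝ) : Prop :=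
  ∀ A : Set (Fin d → ℝ), MeasurableSet A → μ A = ∫⁻ x in A, ENNReal.ofReal (h x) ∂volume

/-- The system `(T, μ)` is mixing. -/
def Mixing {d : ℕ} (T : (Fin d → ℝ) → (Fin d → ℝ)) (μ : Measure (Fin d → ℝ)) : Prop :=
  ∀ A B : Set (Fin d → ℝ), MeasurableSet A → MeasurableSet B →
    Tendsto (fun n : ℕ => μ (T^[n] ⁻¹' A ∩ B)) atTop (𝓝 (μ A * μ B))

/-- A one-dimensional mollifier. -/
def IsMollifier (η : ℝ → ℝ) : Prop :=
  ContDiff ℝ (⊤ : ℕ∞) η ∧ (∀ y, 0 ≤ η y) ∧ Function.support η ⊆ Set.Icc (-1) 1 ∧ ∫ y, η y = 1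

/-- The product mollifier `η̄_δ(x) = δ^{-d} Π_i η(δ⁻¹ x_i)`. -/
def moll (d : ℕ) (η : ℝ → ℝ) (δ : ℝ) (x : Fin d → ℝ) : ℝ :=
  (δ ^ d)⁻¹ * ∏ i, η (δ⁻¹ * x i)

/-- The regularization `h_δ(x) = ∫_Ω η̄_δ(x-y) h(y) dy + δ`. -/
def mollify (d : ℕ) (η : ℝ → ℝ) (Ω : Set (Fin d → ℝ)) (h : (Fin d → ℝ) → ℝ)
    (δ : ℝ) (x : Fin d → ℝ) : ℝ :=
  (∫ y in Ω, moll d η δ (x - y) * h y) + δ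

/-- `ν₀ = ‖(DT)⁻¹‖_{L∞(Ω)}`. -/
def nu0 {d : ℕ} (Ω : Set (Fin d → ℝ)) (T : (Fin d → ℝ) → (Fin d → ℝ)) : ℝ :=
  (essSup (fun x => ENNReal.ofReal (matNorm (jacInv T x))) (volume.restrict Ω)).toReal

/-- The truncated ("open") transfer operators
`L̃_{ε,n} = L_{ε,0} ⋯ L_{ε,n-1}` where `L_{ε,k} f = L((1 - 1_{Γ_{ε ν^k}}) f)`. -/
def tildeOp {d : ℕ} (Ω : Set (Fin d → ℝ)) (T : (Fin d → ℝ) → (Fin d → ℝ))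
    (parts : ℕ → Set (Fin d → ℝ)) (ν : ℝ) :
    ℕ → ℝ → ((Fin d → ℝ) → ℝ) → (Fin d → ℝ) → ℝ
  | 0, _, f => f
  | n + 1, ε, f => transferOp Ω T (((Gam parts ε)ᶜ).indicator (tildeOp Ω T parts ν n (ε * ν) f))

theorem enorm_le_lintegral_enorm_deriv {g : ℝ → ℝ} (hg : ContDiff ℝ 1 g)
    (hgs : HasCompactSupport g) (y : ℝ) : ‖g y‖ₑ ≤ ∫⁻ t, ‖deriv g t‖ₑ :=
  (HasCompactSupport.enorm_le_lintegral_Ici_deriv hg hgs y).trans (setLIntegral_le_lintegral _ _)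

theorem abs_intervalIntegral_mul_deriv_le {I : Set ℝ} {G u v : ℝ → ℝ} (hG : ContDiff ℝ 1 G)
    (hGs : HasCompactSupport G) {a : ℝ} (hu : ∀ y ∈ I, HasDerivAt u (v y) y)
    (hua : ∀ y ∈ I, |u y| ≤ a) (hint : IntegrableOn (fun y => G y * v y) I)
    {p q : ℝ} (hpq : p ≤ q) (hI : Icc p q ⊆ I) :
    |∫ y in Icc p q, G y * v y| ≤ a * ∫ y, |deriv G y| := by
  have hG' : Continuous (deriv G) := hG.continuous_deriv le_rfl
  have hG'i : Integrable (deriv G) := hG'.integrable_of_hasCompactSupport hGs.deriv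
  have hGi : Integrable (fun y => |deriv G y|) := hG'i.abs
  have hp : p ∈ I := hI ⟨le_rfl, hpq⟩
  have hq : q ∈ I := hI ⟨hpq, le_rfl⟩
  have ha : 0 ≤ a := (abs_nonneg _).trans (hua p hp)
  have huc : ContinuousOn u (uIcc p q) := by
    rw [uIcc_of_le hpq]
    exact fun y hy => (hu y (hI hy)).continuousAt.continuousWithinAt
  have hi1 : IntervalIntegrable (fun y => deriv G y * u y) volume p q :=
    (hG'.continuousOn.mul huc).intervalIntegrable
  have hi2 : IntervalIntegrable (fun y => G y * v y) volume p q := by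
    rw [intervalIntegrable_iff_integrableOn_Icc_of_le hpq]
    exact hint.mono_set hI
  have key : ∫ y in p..q, (deriv G y * u y + G y * v y) = G q * u q - G p * u p := by
    refine intervalIntegral.integral_eq_sub_of_hasDerivAt (f := fun y => G y * u y) ?_ (hi1.add hi2)
    intro y hy
    rw [uIcc_of_le hpq] at hy
    exact ((hG.differentiable one_ne_zero y).hasDerivAt).mul (hu y (hI hy))
  rw [intervalIntegral.integral_add hi1 hi2] at key
  rw [integral_Icc_eq_integral_Ioc, ← intervalIntegral.integral_of_le hpq]
  have e1 : |G p| ≤ ∫ y in Iic p, |deriv G y| := by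
    rw [← hGs.integral_Iic_deriv_eq hG p]
    exact abs_integral_le_integral_abs
  have e2 : |G q| ≤ ∫ y in Ioi q, |deriv G y| := by
    rw [← abs_neg (G q), ← hGs.integral_Ioi_deriv_eq hG q]
    exact abs_integral_le_integral_abs
  have e3 : |∫ y in p..q, deriv G y * u y| ≤ a * ∫ y in Ioc p q, |deriv G y| := by
    rw [intervalIntegral.integral_of_le hpq, ← integral_const_mul]
    refine abs_integral_le_integral_abs.trans ?_
    refine setIntegral_mono_on ?_ (hGi.integrableOn.const_mul a) measurableSet_Ioc ?_
    · exact ((intervalIntegrable_iff_integrableOn_Ioc_of_le hpq).1 hi1).abs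
    · intro y hy
      rw [abs_mul, mul_comm]
      exact mul_le_mul_of_nonneg_right (hua y (hI ⟨hy.1.le, hy.2⟩)) (abs_nonneg _)
  have hsplit : ∫ y, |deriv G y| = (∫ y in Iic p, |deriv G y|) + (∫ y in Ioc p q, |deriv G y|)
      + ∫ y in Ioi q, |deriv G y| := by
    rw [← setIntegral_union (Iic_disjoint_Ioc le_rfl) measurableSet_Ioc hGi.integrableOn
      hGi.integrableOn, Iic_union_Ioc_eq_Iic hpq,
      ← setIntegral_union (Iic_disjoint_Ioi le_rfl) measurableSet_Ioi hGi.integrableOn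
      hGi.integrableOn, Iic_union_Ioi, setIntegral_univ]
  have h1 : |G q * u q| ≤ a * |G q| := by
    rw [abs_mul, mul_comm]; exact mul_le_mul_of_nonneg_right (hua q hq) (abs_nonneg _)
  have h2 : |G p * u p| ≤ a * |G p| := by
    rw [abs_mul, mul_comm]; exact mul_le_mul_of_nonneg_right (hua p hp) (abs_nonneg _)
  have h3 := mul_le_mul_of_nonneg_left e1 ha
  have h4 := mul_le_mul_of_nonneg_left e2 ha
  rw [hsplit, mul_add, mul_add]
  rw [abs_le] at *
  constructor <;> linarith [h1.1, h1.2, h2.1, h2.2, e3.1, e3.2]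

/-- Integrating a derivative over an open interval against a test function loses only the sup of
the primitive, because the boundary values of the test function are paid for outside. -/
theorem abs_setIntegral_mul_deriv_le {I : Set ℝ} (hI : IsOpen I) (hc : IsPreconnected I)
    (hb : I ⊆ Icc 0 1) {G u v : ℝ → ℝ} (hG : ContDiff ℝ 1 G) (hGs : HasCompactSupport G)
    {a : ℝ} (hne : I.Nonempty) (hu : ∀ y ∈ I, HasDerivAt u (v y) y) (hua : ∀ y ∈ I, |u y| ≤ a)
    (hint : IntegrableOn (fun y => G y * v y) I) :
    |∫ y in I, G y * v y| ≤ a * ∫ y, |deriv G y| := by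
  have hbb : BddBelow I := bddBelow_Icc.mono hb
  have hba : BddAbove I := bddAbove_Icc.mono hb
  have hIeq : I = Ioo (sInf I) (sSup I) := by
    refine Subset.antisymm ?_ (IsConnected.Ioo_csInf_csSup_subset ⟨hne, hc⟩ hbb hba)
    rw [← interior_Icc]
    exact interior_maximal (subset_Icc_csInf_csSup hbb hba) hI
  obtain ⟨p, -, hp, hpI⟩ := exists_seq_tendsto_sInf hne hbb
  obtain ⟨q, -, hq, hqI⟩ := exists_seq_tendsto_sSup hne hba
  have hcov : AECover (volume.restrict I) atTop fun n => Icc (p n) (q n) := by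
    rw [hIeq]; exact aecover_Ioo_of_Icc hp hq
  have hlim := hcov.integral_tendsto_of_countably_generated hint
  have ha : 0 ≤ a := by
    obtain ⟨y, hy⟩ := hne
    exact (abs_nonneg _).trans (hua y hy)
  refine le_of_tendsto hlim.abs (Eventually.of_forall fun n => ?_)
  rcases le_or_gt (p n) (q n) with h | h
  · have hsub : Icc (p n) (q n) ⊆ I := hc.Icc_subset (hpI n) (hqI n)
    rw [Measure.restrict_restrict measurableSet_Icc, inter_eq_self_of_subset_left hsub]
    exact abs_intervalIntegral_mul_deriv_le hG hGs hu hua hint h hsub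
  · rw [Icc_eq_empty (not_le.2 h), setIntegral_empty, abs_zero]
    exact mul_nonneg ha (integral_nonneg fun _ => abs_nonneg _)

/-- A finite `C¹` partition of unity on `[0,1]` at scale `δ`. -/
theorem exists_partition_unit {δ : ℝ} (hδ : 0 < δ) :
    ∃ (s : Finset ℝ) (χ : ℝ → ℝ → ℝ) (K : ℝ), 0 ≤ K ∧ (∀ c ∈ s, c ∈ Icc (0:ℝ) 1) ∧
      (∀ c ∈ s, ContDiff ℝ 1 (χ c)) ∧ (∀ c ∈ s, ∀ y, 0 ≤ χ c y) ∧
      (∀ c ∈ s, ∀ y, y ∉ Icc (c - δ) (c + δ) → χ c y = 0) ∧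
      (∀ y, ∑ c ∈ s, χ c y ≤ 1) ∧ (∀ y ∈ Icc (0:ℝ) 1, ∑ c ∈ s, χ c y = 1) ∧
      (∀ y, ∑ c ∈ s, |deriv (χ c) y| ≤ K) := by
  obtain ⟨t, ht, hcov⟩ := (isCompact_Icc (a := (0:ℝ)) (b := 1)).elim_nhds_subcover
    (fun c => Metric.ball c δ) (fun c _ => Metric.ball_mem_nhds c hδ)
  obtain ⟨f, hf⟩ := SmoothPartitionOfUnity.exists_isSubordinate
    (ι := t) (modelWithCornersSelf ℝ ℝ) (isClosed_Icc (a := (0:ℝ)) (b := 1))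
    (fun c => Metric.ball (c:ℝ) δ) (fun c => Metric.isOpen_ball) (by
      intro y hy
      obtain ⟨c, hc, hyc⟩ := mem_iUnion₂.1 (hcov hy)
      exact mem_iUnion.2 ⟨⟨c, hc⟩, hyc⟩)
  have hsm : ∀ c, ContDiff ℝ 1 (f c) := fun c =>
    ((f c).contMDiff.contDiff).of_le (by exact_mod_cast le_top)
  have hcs : ∀ c, HasCompactSupport (f c) := fun c =>
    HasCompactSupport.of_support_subset_isCompact (isCompact_closedBall (c:ℝ) δ)
      ((subset_tsupport _).trans ((hf c).trans Metric.ball_subset_closedBall))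
  have hK : ∀ c, ∃ K : ℝ, 0 ≤ K ∧ ∀ y, |deriv (f c) y| ≤ K := by
    intro c
    obtain ⟨K, hK⟩ := ((hsm c).continuous_deriv le_rfl).bounded_above_of_compact_support
      (hcs c).deriv
    exact ⟨K, (norm_nonneg _).trans (hK 0), hK⟩
  choose K hK0 hK using hK
  let χ : ℝ → ℝ → ℝ := fun c => if h : c ∈ t then f ⟨c, h⟩ else 0
  have hχ : ∀ c : t, χ c = f c := fun c => by simp [χ]
  have hsum : ∀ y, ∑ c ∈ t, χ c y = ∑ᶠ c, f c y := by
    intro y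
    rw [finsum_eq_sum_of_fintype, ← Finset.sum_coe_sort t]
    simp [hχ]
  refine ⟨t, χ, ∑ c, K c, Finset.sum_nonneg fun c _ => hK0 c, ht, ?_, ?_, ?_, ?_, ?_, ?_⟩
  · intro c hc; rw [hχ ⟨c, hc⟩]; exact hsm _
  · intro c hc y; rw [hχ ⟨c, hc⟩]; exact f.nonneg _ _
  · intro c hc y hy
    rw [hχ ⟨c, hc⟩]
    by_contra h
    have : y ∈ Metric.ball c δ := (subset_tsupport _).trans (hf ⟨c, hc⟩) h
    rw [Real.ball_eq_Ioo] at this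
    exact hy (Ioo_subset_Icc_self this)
  · intro y; rw [hsum]; exact f.sum_le_one y
  · intro y hy; rw [hsum]; exact f.sum_eq_one hy
  · intro y
    rw [← Finset.sum_coe_sort t]
    refine Finset.sum_le_sum fun c _ => ?_
    rw [hχ]; exact hK c y

/-- The one-dimensional Lasota-Yorke estimate along a line. -/
theorem exists_slice_estimate {δ : ℝ} (hδ : 0 < δ) :
    ∃ K : ℝ≥0, ∀ (θ : ℝ≥0∞) (I : ℕ × ℕ → Set ℝ) (a : ℕ × ℕ → ℝ≥0∞) (g u v : ℝ → ℝ),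
      θ ≠ ∞ → (∀ p, IsOpen (I p)) → (∀ p, IsPreconnected (I p)) → (∀ p, I p ⊆ Icc 0 1) →
      Pairwise (Function.onFun Disjoint I) →
      (∀ c ∈ Icc (0:ℝ) 1, (∑' p, if (Icc (c - δ) (c + δ) ∩ I p).Nonempty then a p else 0) ≤ θ) →
      ContDiff ℝ 1 g → HasCompactSupport g →
      (∀ p, ∀ y ∈ I p, HasDerivAt u (v y) y) → (∀ p, ∀ y ∈ I p, ENNReal.ofReal |u y| ≤ a p) →
      (∀ y, (∀ p, y ∉ I p) → v y = 0) → Integrable (fun y => g y * v y) →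
      ‖∫ y, g y * v y‖ₑ ≤ θ * ((∫⁻ y, ‖deriv g y‖ₑ) + K * ∫⁻ y, ‖g y‖ₑ) := by
  obtain ⟨s, χ, K, hK0, hsc, hχ1, hχ0, hχs, hχle, hχeq, hχK⟩ := exists_partition_unit hδ
  refine ⟨K.toNNReal, fun θ I a g u v hθ hIo hIc hIb hId hθa hg hgs hu hua hv hint => ?_⟩
  have hvU : ∀ y, v y ≠ 0 → y ∈ Icc (0:ℝ) 1 := by
    intro y hy
    by_contra h
    exact hy (hv y fun p hp => h (hIb p hp))
  have hGi : ∀ c ∈ s, Integrable (fun y => (g y * χ c y) * v y) := by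
    intro c hc
    have : (fun y => (g y * χ c y) * v y) = fun y => χ c y * (g y * v y) := by
      ext y; ring
    rw [this]
    refine hint.bdd_mul (c := 1) (hχ1 c hc).continuous.aestronglyMeasurable
      (Eventually.of_forall fun y => ?_)
    rw [Real.norm_of_nonneg (hχ0 c hc y)]
    exact (Finset.single_le_sum (f := fun c => χ c y) (fun c hc => hχ0 c hc y) hc).trans (hχle y)
  have hdec : ∫ y, g y * v y = ∑ c ∈ s, ∫ y, (g y * χ c y) * v y := by
    rw [← integral_finsetSum _ hGi]
    refine integral_congr_ae (Eventually.of_forall fun y => ?_)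
    by_cases h : v y = 0
    · simp [h]
    · have := hχeq y (hvU y h)
      simp only []
      rw [← Finset.sum_mul, ← Finset.mul_sum, this, mul_one]
  have hone : ∀ c ∈ s, ‖∫ y, (g y * χ c y) * v y‖ₑ
      ≤ θ * ∫⁻ y, ‖deriv (fun y => g y * χ c y) y‖ₑ := by
    intro c hc
    have hG : ContDiff ℝ 1 (fun y => g y * χ c y) := hg.mul (hχ1 c hc)
    have hGs : HasCompactSupport (fun y => g y * χ c y) := hgs.mul_right
    have hzero : ∀ y ∉ ⋃ p, I p, (g y * χ c y) * v y = 0 := by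
      intro y hy
      rw [hv y (fun p hp => hy (mem_iUnion.2 ⟨p, hp⟩)), mul_zero]
    have hnn : ENNReal.ofReal (∫ y, |deriv (fun y => g y * χ c y) y|)
        = ∫⁻ y, ‖deriv (fun y => g y * χ c y) y‖ₑ := by
      rw [ofReal_integral_eq_lintegral_ofReal]
      · simp_rw [Real.enorm_eq_ofReal_abs]
      · exact ((hG.continuous_deriv le_rfl).integrable_of_hasCompactSupport hGs.deriv).abs
      · exact Eventually.of_forall fun _ => abs_nonneg _
    rw [← setIntegral_eq_integral_of_forall_compl_eq_zero hzero,
      integral_iUnion (fun p => (hIo p).measurableSet) hId (hGi c hc).integrableOn]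
    refine enorm_tsum_le_tsum_enorm.trans ?_
    rw [← hnn]
    refine le_trans ?_ (mul_le_mul_left (hθa c (hsc c hc)) _)
    rw [← ENNReal.tsum_mul_right]
    refine ENNReal.tsum_le_tsum fun p => ?_
    split_ifs with hne
    · have hap : a p ≠ ∞ := by
        refine ne_top_of_le_ne_top hθ (le_trans ?_ (hθa c (hsc c hc)))
        refine le_trans ?_ (ENNReal.le_tsum p)
        rw [if_pos hne]
      rw [← ENNReal.ofReal_toReal hap, ← ENNReal.ofReal_mul ENNReal.toReal_nonneg,
        Real.enorm_eq_ofReal_abs]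
      refine ENNReal.ofReal_le_ofReal ?_
      refine abs_setIntegral_mul_deriv_le (hIo p) (hIc p) (hIb p) hG hGs (hne.mono inter_subset_right)
        (hu p) (fun y hy => ?_) (hGi c hc).integrableOn
      exact (ENNReal.ofReal_le_iff_le_toReal hap).1 (hua p y hy)
    · rw [setIntegral_eq_zero_of_forall_eq_zero]
      · simp
      · intro y hy
        rw [hχs c hc y fun h => hne ⟨y, h, hy⟩]; simp
  rw [hdec]
  refine (enorm_sum_le _ _).trans ((Finset.sum_le_sum hone).trans ?_)
  rw [← Finset.mul_sum]
  refine mul_le_mul_right ?_ _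
  have hmeas : ∀ c ∈ s, Measurable fun y => ‖deriv (fun y => g y * χ c y) y‖ₑ :=
    fun c _ => (measurable_deriv _).enorm
  rw [← lintegral_finsetSum' _ fun c hc => (hmeas c hc).aemeasurable,
    ← lintegral_const_mul _ hg.continuous.measurable.enorm,
    ← lintegral_add_left (measurable_deriv _).enorm]
  refine lintegral_mono fun y => ?_
  have hd : ∀ c ∈ s, ‖deriv (fun y => g y * χ c y) y‖ₑ
      ≤ ENNReal.ofReal (|deriv g y| * χ c y + |g y| * |deriv (χ c) y|) := by
    intro c hc
    have : deriv (fun y => g y * χ c y) y = deriv g y * χ c y + g y * deriv (χ c) y :=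
      ((hg.differentiable one_ne_zero y).hasDerivAt.mul
        ((hχ1 c hc).differentiable one_ne_zero y).hasDerivAt).deriv
    rw [this, Real.enorm_eq_ofReal_abs]
    refine ENNReal.ofReal_le_ofReal ((abs_add_le _ _).trans ?_)
    rw [abs_mul, abs_mul, abs_of_nonneg (hχ0 c hc y)]
  refine (Finset.sum_le_sum hd).trans ?_
  rw [← ENNReal.ofReal_sum_of_nonneg]
  · rw [Real.enorm_eq_ofReal_abs, Real.enorm_eq_ofReal_abs, ← ENNReal.ofReal_coe_nnreal,
      Real.coe_toNNReal K hK0,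
      ← ENNReal.ofReal_mul hK0, ← ENNReal.ofReal_add (abs_nonneg _) (by positivity)]
    refine ENNReal.ofReal_le_ofReal ?_
    rw [Finset.sum_add_distrib, ← Finset.mul_sum, ← Finset.mul_sum, mul_comm K]
    exact add_le_add (mul_le_of_le_one_right (abs_nonneg _) (hχle y))
      (mul_le_mul_of_nonneg_left (hχK y) (abs_nonneg _))
  · intro c hc
    have := hχ0 c hc y
    positivity

theorem jac_eq_toMatrix' {d : ℕ} (T : (Fin d → ℝ) → (Fin d → ℝ)) (x : Fin d → ℝ) :
    jac T x = LinearMap.toMatrix' (fderiv ℝ T x : (Fin d → ℝ) →ₗ[ℝ] (Fin d → ℝ)) := by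
  ext i j
  simp only [jac, Matrix.of_apply, LinearMap.toMatrix'_apply, ContinuousLinearMap.coe_coe]

theorem det_jac {d : ℕ} (T : (Fin d → ℝ) → (Fin d → ℝ)) (x : Fin d → ℝ) :
    (jac T x).det = (fderiv ℝ T x).det := by
  rw [jac_eq_toMatrix', LinearMap.det_toMatrix', ContinuousLinearMap.det]

namespace PES

variable {d : ℕ} (S : PES d)

theorem parts_subset (k : ℕ) : S.parts k ⊆ S.Ω := S.parts_union ▸ subset_iUnion S.parts k

theorem exists_mem_parts {x : Fin d → ℝ} (hx : x ∈ S.Ω) : ∃ k, x ∈ S.parts k := by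
  rw [← S.parts_union] at hx
  exact mem_iUnion.1 hx

theorem eq_of_mem_parts {x : Fin d → ℝ} {k l : ℕ} (hk : x ∈ S.parts k) (hl : x ∈ S.parts l) :
    k = l := by
  by_contra h
  exact (Set.disjoint_left.1 (S.parts_disj h) hk) hl

theorem contDiffAt_T {x : Fin d → ℝ} (hx : x ∈ S.Ω) : ContDiffAt ℝ 2 S.T x := by
  obtain ⟨k, hk⟩ := S.exists_mem_parts hx
  exact (S.T_C2 k).contDiffAt ((S.parts_open k).mem_nhds hk)

theorem hasFDerivAt_T {x : Fin d → ℝ} (hx : x ∈ S.Ω) : HasFDerivAt S.T (fderiv ℝ S.T x) x :=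
  ((S.contDiffAt_T hx).differentiableAt two_ne_zero).hasFDerivAt

theorem continuousOn_T : ContinuousOn S.T S.Ω := fun _ hx =>
  (S.contDiffAt_T hx).continuousAt.continuousWithinAt

theorem det_ne_zero {x : Fin d → ℝ} (hx : x ∈ S.Ω) : (jac S.T x).det ≠ 0 := by
  obtain ⟨k, hk⟩ := S.exists_mem_parts hx
  obtain ⟨σ, hσ, hσT⟩ := S.T_inv k
  have h1 : HasFDerivWithinAt σ (fderivWithin ℝ σ (S.T '' S.parts k) (S.T x))
      (S.T '' S.parts k) (S.T x) :=
    ((hσ.differentiableOn one_ne_zero) _ (mem_image_of_mem _ hk)).hasFDerivWithinAt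
  have h2 : HasFDerivWithinAt (σ ∘ S.T) _ (S.parts k) x :=
    h1.comp x (S.hasFDerivAt_T hx).hasFDerivWithinAt (mapsTo_image _ _)
  have h3 : HasFDerivAt (σ ∘ S.T) _ x := h2.hasFDerivAt ((S.parts_open k).mem_nhds hk)
  have h4 : HasFDerivAt (σ ∘ S.T) (ContinuousLinearMap.id ℝ _) x := by
    refine (hasFDerivAt_id x).congr_of_eventuallyEq ?_
    filter_upwards [(S.parts_open k).mem_nhds hk] with y hy using hσT y hy
  have h5 := h3.unique h4
  rw [det_jac, ContinuousLinearMap.det]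
  intro h0
  have h6 := congrArg (fun A : (Fin d → ℝ) →L[ℝ] (Fin d → ℝ) =>
    LinearMap.det (A : (Fin d → ℝ) →ₗ[ℝ] (Fin d → ℝ))) h5
  rw [ContinuousLinearMap.toLinearMap_comp, LinearMap.det_comp, h0, mul_zero,
    ContinuousLinearMap.coe_id, LinearMap.det_id] at h6
  exact zero_ne_one h6

theorem injOn_T (k : ℕ) : InjOn S.T (S.parts k) := by
  obtain ⟨σ, -, hσ⟩ := S.T_inv k
  intro x hx y hy h
  rw [← hσ x hx, ← hσ y hy, h]

/-- The inverse branch of `T` on the `k`-th part. -/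
def branch (k : ℕ) : (Fin d → ℝ) → (Fin d → ℝ) := (S.T_inv k).choose

theorem branch_T {k : ℕ} {x : Fin d → ℝ} (hx : x ∈ S.parts k) : S.branch k (S.T x) = x :=
  (S.T_inv k).choose_spec.2 x hx

/-- The contribution of the `k`-th inverse branch to the transfer operator. -/
def branchTerm (h : (Fin d → ℝ) → ℝ) (k : ℕ) : (Fin d → ℝ) → ℝ :=
  (S.T '' S.parts k).indicator fun x =>
    |(jac S.T (S.branch k x)).det|⁻¹ * h (S.branch k x)

theorem branchTerm_T {k : ℕ} {y : Fin d → ℝ} (hy : y ∈ S.parts k) (h : (Fin d → ℝ) → ℝ) :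
    S.branchTerm h k (S.T y) = |(jac S.T y).det|⁻¹ * h y := by
  rw [branchTerm, indicator_of_mem (mem_image_of_mem _ hy), S.branch_T hy]

theorem transferOp_eq_tsum (h : (Fin d → ℝ) → ℝ) (x : Fin d → ℝ) :
    transferOp S.Ω S.T h x = ∑' k, S.branchTerm h k x := by
  choose! κ hκ using fun y hy => S.exists_mem_parts (x := y) hy
  have hinj : Function.Injective fun y : ↥(S.Ω ∩ S.T ⁻¹' {x}) => κ y := by
    intro y z hyz
    have hy := hκ y y.2.1
    have hz := hκ z z.2.1
    simp only at hyz
    rw [← hyz] at hz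
    exact Subtype.ext (S.injOn_T _ hy hz (y.2.2.trans (Eq.symm z.2.2)))
  rw [← hinj.tsum_eq]
  · refine tsum_congr fun y => ?_
    have hy : S.T y = x := y.2.2
    rw [← S.branchTerm_T (hκ y y.2.1) h]
    exact congrArg _ hy
  · intro k hk
    obtain ⟨y, hy, hyx⟩ : x ∈ S.T '' S.parts k := by
      by_contra hn
      exact hk (indicator_of_notMem hn _)
    have hyΩ := S.parts_subset k hy
    exact ⟨⟨y, hyΩ, hyx⟩, S.eq_of_mem_parts (hκ y hyΩ) hy⟩

theorem measurableSet_image (k : ℕ) : MeasurableSet (S.T '' S.parts k) :=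
  (S.parts_open k).measurableSet.image_of_continuousOn_injOn
    (S.continuousOn_T.mono (S.parts_subset k)) (S.injOn_T k)

theorem hasFDerivWithinAt_T (k : ℕ) : ∀ x ∈ S.parts k,
    HasFDerivWithinAt S.T (fderiv ℝ S.T x) (S.parts k) x := fun _ hx =>
  (S.hasFDerivAt_T (S.parts_subset k hx)).hasFDerivWithinAt

theorem abs_det_mul_branchTerm {k : ℕ} {y : Fin d → ℝ} (hy : y ∈ S.parts k)
    (h : (Fin d → ℝ) → ℝ) : |(fderiv ℝ S.T y).det| * S.branchTerm h k (S.T y) = h y := by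
  rw [S.branchTerm_T hy, ← det_jac, mul_inv_cancel_left₀]
  exact abs_ne_zero.2 (S.det_ne_zero (S.parts_subset k hy))

theorem integrable_branchTerm {h : (Fin d → ℝ) → ℝ} (hh : IntegrableOn h S.Ω) (k : ℕ) :
    Integrable (S.branchTerm h k) := by
  have h1 : IntegrableOn (S.branchTerm h k) (S.T '' S.parts k) := by
    rw [integrableOn_image_iff_integrableOn_abs_det_fderiv_smul volume
      (S.parts_open k).measurableSet (S.hasFDerivWithinAt_T k) (S.injOn_T k)]
    refine (hh.mono_set (S.parts_subset k)).congr_fun (fun y hy => ?_)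
      (S.parts_open k).measurableSet
    simp only [smul_eq_mul]
    rw [S.abs_det_mul_branchTerm hy]
  rw [branchTerm] at h1 ⊢
  rw [integrable_indicator_iff (S.measurableSet_image k)]
  refine h1.congr_fun (fun y hy => ?_) (S.measurableSet_image k)
  rw [indicator_of_mem hy]

theorem integral_branchTerm_mul (h ψ : (Fin d → ℝ) → ℝ) (k : ℕ) :
    ∫ x, S.branchTerm h k x * ψ x = ∫ y in S.parts k, h y * ψ (S.T y) := by
  have h0 : ∀ x ∉ S.T '' S.parts k, S.branchTerm h k x * ψ x = 0 := by
    intro x hx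
    rw [branchTerm, indicator_of_notMem hx, zero_mul]
  rw [← setIntegral_eq_integral_of_forall_compl_eq_zero h0,
    integral_image_eq_integral_abs_det_fderiv_smul volume
      (S.parts_open k).measurableSet (S.hasFDerivWithinAt_T k) (S.injOn_T k)]
  refine setIntegral_congr_fun (S.parts_open k).measurableSet fun y hy => ?_
  simp only [smul_eq_mul]
  rw [← mul_assoc, S.abs_det_mul_branchTerm hy]

theorem lintegral_branchTerm (h : (Fin d → ℝ) → ℝ) (k : ℕ) :
    ∫⁻ x, ‖S.branchTerm h k x‖ₑ = ∫⁻ y in S.parts k, ‖h y‖ₑ := by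
  have h0 : (fun x => ‖S.branchTerm h k x‖ₑ)
      = (S.T '' S.parts k).indicator fun x => ‖S.branchTerm h k x‖ₑ := by
    ext x
    by_cases hx : x ∈ S.T '' S.parts k
    · rw [indicator_of_mem hx]
    · rw [indicator_of_notMem hx, branchTerm, indicator_of_notMem hx, enorm_zero]
  rw [h0, lintegral_indicator (S.measurableSet_image k),
    lintegral_image_eq_lintegral_abs_det_fderiv_mul volume
      (S.parts_open k).measurableSet (S.hasFDerivWithinAt_T k) (S.injOn_T k)]
  refine setLIntegral_congr_fun (S.parts_open k).measurableSet fun y hy => ?_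
  rw [← S.abs_det_mul_branchTerm hy h, enorm_mul, Real.enorm_eq_ofReal_abs |_|, abs_abs]

theorem tsum_lintegral_branchTerm (h : (Fin d → ℝ) → ℝ) :
    ∑' k, ∫⁻ x, ‖S.branchTerm h k x‖ₑ = ∫⁻ y in S.Ω, ‖h y‖ₑ := by
  simp_rw [S.lintegral_branchTerm]
  rw [← S.parts_union, lintegral_iUnion (fun k => (S.parts_open k).measurableSet) S.parts_disj]

theorem ae_summable_branchTerm {h : (Fin d → ℝ) → ℝ} (hh : IntegrableOn h S.Ω) :
    ∀ᵐ x, Summable fun k => S.branchTerm h k x := by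
  have h1 : ∫⁻ x, ∑' k, ‖S.branchTerm h k x‖ₑ ≠ ∞ := by
    rw [lintegral_tsum fun k => (S.integrable_branchTerm hh k).aestronglyMeasurable.enorm,
      S.tsum_lintegral_branchTerm]
    exact hh.2.ne
  filter_upwards [ae_lt_top' (AEMeasurable.tsum fun k =>
    (S.integrable_branchTerm hh k).aestronglyMeasurable.enorm) h1] with x hx
  exact Summable.of_enorm hx.ne

theorem lintegral_transferOp_le {h : (Fin d → ℝ) → ℝ} (hh : IntegrableOn h S.Ω) :
    ∫⁻ x, ‖transferOp S.Ω S.T h x‖ₑ ≤ ∫⁻ x in S.Ω, ‖h x‖ₑ := by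
  rw [← S.tsum_lintegral_branchTerm,
    ← lintegral_tsum fun k => (S.integrable_branchTerm hh k).aestronglyMeasurable.enorm]
  refine lintegral_mono fun x => ?_
  rw [S.transferOp_eq_tsum]
  exact enorm_tsum_le_tsum_enorm

theorem integrable_transferOp {h : (Fin d → ℝ) → ℝ} (hh : IntegrableOn h S.Ω) :
    Integrable (transferOp S.Ω S.T h) := by
  refine ⟨?_, (S.lintegral_transferOp_le hh).trans_lt hh.2⟩
  refine AEMeasurable.aestronglyMeasurable ?_
  refine aemeasurable_of_tendsto_metrizable_ae (u := atTop)
    (f := fun n x => ∑ k ∈ Finset.range n, S.branchTerm h k x)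
    (fun n => Finset.aemeasurable_fun_sum _ fun k _ => (S.integrable_branchTerm hh k).aemeasurable) ?_
  filter_upwards [S.ae_summable_branchTerm hh] with x hx
  rw [S.transferOp_eq_tsum]
  exact hx.hasSum.tendsto_sum_nat

/-- The duality relation between the transfer operator and composition with `T`. -/
theorem integral_transferOp_mul {h ψ : (Fin d → ℝ) → ℝ} (hh : IntegrableOn h S.Ω)
    (hψ : Continuous ψ) {M : ℝ} (hM : ∀ x, |ψ x| ≤ M) :
    ∫ x, transferOp S.Ω S.T h x * ψ x = ∫ y in S.Ω, h y * ψ (S.T y) := by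
  have hint : IntegrableOn (fun y => h y * ψ (S.T y)) S.Ω := by
    refine Integrable.mul_bdd (c := M) hh ?_ (Eventually.of_forall fun y => hM _)
    exact (hψ.comp_continuousOn S.continuousOn_T).aestronglyMeasurable S.Ω_open.measurableSet
  have hsum : ∑' k, ∫⁻ x, ‖S.branchTerm h k x * ψ x‖ₑ ≠ ∞ := by
    have : ∑' k, ∫⁻ x, ‖S.branchTerm h k x * ψ x‖ₑ
        ≤ (∫⁻ y in S.Ω, ‖h y‖ₑ) * ENNReal.ofReal M := by
      rw [← S.tsum_lintegral_branchTerm, ← ENNReal.tsum_mul_right]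
      refine ENNReal.tsum_le_tsum fun k => ?_
      rw [← lintegral_mul_const' _ _ ENNReal.ofReal_ne_top]
      refine lintegral_mono fun x => ?_
      rw [enorm_mul]
      refine mul_le_mul_right ?_ _
      rw [Real.enorm_eq_ofReal_abs]
      exact ENNReal.ofReal_le_ofReal (hM x)
    exact ne_top_of_le_ne_top (ENNReal.mul_ne_top hh.2.ne ENNReal.ofReal_ne_top) this
  simp_rw [S.transferOp_eq_tsum, ← tsum_mul_right]
  rw [integral_tsum (f := fun k x => S.branchTerm h k x * ψ x) (fun k => (S.integrable_branchTerm hh k).aestronglyMeasurable.mul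
    hψ.aestronglyMeasurable) hsum]
  simp_rw [S.integral_branchTerm_mul]
  rw [← integral_iUnion (fun k => (S.parts_open k).measurableSet) S.parts_disj
    (by rwa [S.parts_union]), S.parts_union]

theorem transferOp_sub_ae {g h : (Fin d → ℝ) → ℝ} (hg : IntegrableOn g S.Ω)
    (hh : IntegrableOn h S.Ω) :
    (fun x => transferOp S.Ω S.T g x - transferOp S.Ω S.T h x)
      =ᵐ[volume] transferOp S.Ω S.T fun x => g x - h x := by
  filter_upwards [S.ae_summable_branchTerm hg, S.ae_summable_branchTerm hh] with x h1 h2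
  rw [S.transferOp_eq_tsum, S.transferOp_eq_tsum, S.transferOp_eq_tsum, ← h1.tsum_sub h2]
  refine tsum_congr fun k => ?_
  by_cases hx : x ∈ S.T '' S.parts k
  · simp only [branchTerm, indicator_of_mem hx]; ring
  · simp only [branchTerm, indicator_of_notMem hx, sub_zero]

theorem transferOp_eq_zero {h : (Fin d → ℝ) → ℝ} {x : Fin d → ℝ} (hx : x ∉ Icc 0 1) :
    transferOp S.Ω S.T h x = 0 := by
  rw [S.transferOp_eq_tsum]
  convert tsum_zero with k
  refine indicator_of_notMem ?_ _
  rintro ⟨y, hy, rfl⟩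
  exact hx (closure_minimal S.Ω_subset isClosed_Icc (S.T_maps (S.parts_subset k hy)))

end PES

theorem contDiffAt_matrix_det {E : Type*} [NormedAddCommGroup E] [NormedSpace ℝ E] {d : ℕ}
    {n : WithTop ℕ∞} {A : E → Matrix (Fin d) (Fin d) ℝ} {x : E}
    (hA : ∀ i j, ContDiffAt ℝ n (fun z => A z i j) x) :
    ContDiffAt ℝ n (fun z => (A z).det) x := by
  simp only [Matrix.det_apply, Units.smul_def, zsmul_eq_mul]
  exact ContDiffAt.sum fun σ _ => contDiffAt_const.mul (contDiffAt_prod fun i _ => hA _ _)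

theorem contDiffAt_matrix_inv {E : Type*} [NormedAddCommGroup E] [NormedSpace ℝ E] {d : ℕ}
    {n : WithTop ℕ∞} {A : E → Matrix (Fin d) (Fin d) ℝ} {x : E}
    (hA : ∀ i j, ContDiffAt ℝ n (fun z => A z i j) x) (hdet : (A x).det ≠ 0) (i j : Fin d) :
    ContDiffAt ℝ n (fun z => (A z)⁻¹ i j) x := by
  simp only [Matrix.inv_def, Ring.inverse_eq_inv', Matrix.smul_apply, smul_eq_mul,
    Matrix.adjugate_apply]
  refine ((contDiffAt_matrix_det hA).inv hdet).mul (contDiffAt_matrix_det fun k l => ?_)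
  by_cases hk : k = j
  · subst hk
    simpa using contDiffAt_const
  · simpa [Matrix.updateRow_apply, hk] using hA k l

theorem abs_sum_row_mul_le {d : ℕ} (A : Matrix (Fin d) (Fin d) ℝ) {v : Fin d → ℝ} (hv : ‖v‖ ≤ 1)
    (j : Fin d) : |∑ i, A j i * v i| ≤ matNorm A := by
  calc |∑ i, A j i * v i| ≤ ∑ i, |A j i * v i| := Finset.abs_sum_le_sum_abs _ _
    _ ≤ ∑ i, |A j i| := by
        refine Finset.sum_le_sum fun i _ => ?_
        rw [abs_mul]
        exact mul_le_of_le_one_right (abs_nonneg _) ((norm_le_pi_norm v i).trans hv)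
    _ = ((∑ i, ‖A j i‖₊ : ℝ≥0) : ℝ) := by simp
    _ ≤ matNorm A := NNReal.coe_le_coe.2
        (Finset.le_sup (f := fun i => ∑ j, ‖A i j‖₊) (Finset.mem_univ j))

/-- The `j`-th component of `(DT)⁻¹ (φ ∘ T)`. -/
def flux {d : ℕ} (T φ : (Fin d → ℝ) → (Fin d → ℝ)) (j : Fin d) (x : Fin d → ℝ) : ℝ :=
  ∑ i, jacInv T x j i * φ (T x) i

/-- The part of `∂_j (flux T φ j)` in which the derivative falls on `(DT)⁻¹`. -/
def fluxDist {d : ℕ} (T φ : (Fin d → ℝ) → (Fin d → ℝ)) (j : Fin d) (x : Fin d → ℝ) : ℝ :=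
  ∑ i, jacDj T j x j i * φ (T x) i

/-- The part of `∂_j (flux T φ j)` in which the derivative falls on `φ ∘ T`. -/
def fluxMain {d : ℕ} (T φ : (Fin d → ℝ) → (Fin d → ℝ)) (j : Fin d) (x : Fin d → ℝ) : ℝ :=
  ∑ i, jacInv T x j i * ∑ l, jac T x l j * fderiv ℝ φ (T x) (Pi.single l 1) i

namespace PES

variable {d : ℕ} (S : PES d)

theorem contDiffAt_jac {x : Fin d → ℝ} (hx : x ∈ S.Ω) (i j : Fin d) :
    ContDiffAt ℝ 1 (fun z => jac S.T z i j) x := by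
  have h := (S.contDiffAt_T hx).fderiv_right (m := 1) (by norm_num)
  exact contDiffAt_pi.1 (h.clm_apply contDiffAt_const) i

theorem contDiffAt_jacInv {x : Fin d → ℝ} (hx : x ∈ S.Ω) (i j : Fin d) :
    ContDiffAt ℝ 1 (fun z => jacInv S.T z i j) x :=
  contDiffAt_matrix_inv (S.contDiffAt_jac hx) (S.det_ne_zero hx) i j

theorem hasDerivAt_jacInv_update {x : Fin d → ℝ} (hx : x ∈ S.Ω) (j i i' : Fin d) :
    HasDerivAt (fun y => jacInv S.T (Function.update x j y) i i')
      (fderiv ℝ (fun z => jacInv S.T z i i') x (Pi.single j 1)) (x j) := by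
  have h := ((S.contDiffAt_jacInv hx i i').differentiableAt (by norm_num)).hasFDerivAt
  rw [← Function.update_eq_self j x] at h
  exact h.comp_hasDerivAt (x j) (hasDerivAt_update x j (x j)) |>.congr_deriv
    (by rw [Function.update_eq_self])

theorem jacDj_eq {x : Fin d → ℝ} (hx : x ∈ S.Ω) (j i i' : Fin d) :
    jacDj S.T j x i i' = fderiv ℝ (fun z => jacInv S.T z i i') x (Pi.single j 1) :=
  (S.hasDerivAt_jacInv_update hx j i i').deriv

theorem hasDerivAt_flux {φ : (Fin d → ℝ) → (Fin d → ℝ)} (hφ : ContDiff ℝ 1 φ)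
    {x : Fin d → ℝ} (hx : x ∈ S.Ω) (j : Fin d) :
    HasDerivAt (fun y => flux S.T φ j (Function.update x j y))
      (fluxMain S.T φ j x + fluxDist S.T φ j x) (x j) := by
  have hT : HasDerivAt (fun y => S.T (Function.update x j y))
      (fderiv ℝ S.T x (Pi.single j 1)) (x j) := by
    have h := S.hasFDerivAt_T hx
    have h' : HasFDerivAt S.T (fderiv ℝ S.T x) (Function.update x j (x j)) := by
      rwa [Function.update_eq_self]
    exact h'.comp_hasDerivAt (x j) (hasDerivAt_update x j (x j))
  have hφT : HasDerivAt (fun y => φ (S.T (Function.update x j y)))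
      (fderiv ℝ φ (S.T x) (fderiv ℝ S.T x (Pi.single j 1))) (x j) := by
    have h := ((hφ.differentiable (by norm_num)) (S.T x)).hasFDerivAt
    have h' : HasFDerivAt φ (fderiv ℝ φ (S.T x)) (S.T (Function.update x j (x j))) := by
      rwa [Function.update_eq_self]
    exact h'.comp_hasDerivAt (x j) hT
  have hexp : ∀ i, fderiv ℝ φ (S.T x) (fderiv ℝ S.T x (Pi.single j 1)) i
      = ∑ l, jac S.T x l j * fderiv ℝ φ (S.T x) (Pi.single l 1) i := by
    intro i
    conv_lhs => rw [pi_eq_sum_univ' (fderiv ℝ S.T x (Pi.single j 1))]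
    rw [map_sum, Finset.sum_apply]
    refine Finset.sum_congr rfl fun l _ => ?_
    rw [map_smul, Pi.smul_apply, smul_eq_mul]
    congr 3
  have := HasDerivAt.fun_sum (u := Finset.univ) fun i _ =>
    (S.hasDerivAt_jacInv_update hx j j i).mul (hasDerivAt_pi.1 hφT i)
  refine this.congr_deriv ?_
  simp only [Function.update_eq_self, fluxMain, fluxDist, ← hexp, ← S.jacDj_eq hx]
  rw [Finset.sum_add_distrib, add_comm]

theorem sum_fluxMain (φ : (Fin d → ℝ) → (Fin d → ℝ)) {x : Fin d → ℝ} (hx : x ∈ S.Ω) :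
    ∑ j, fluxMain S.T φ j x = divg φ (S.T x) := by
  have hinv : jac S.T x * jacInv S.T x = 1 :=
    Matrix.mul_nonsing_inv _ (S.det_ne_zero hx).isUnit
  have h1 : ∀ l i, ∑ j, jac S.T x l j * jacInv S.T x j i = if l = i then 1 else 0 := by
    intro l i
    rw [← Matrix.mul_apply, hinv, Matrix.one_apply]
  simp only [fluxMain, Finset.mul_sum, divg]
  rw [Finset.sum_comm]
  refine Finset.sum_congr rfl fun i _ => ?_
  rw [Finset.sum_comm]
  calc ∑ l, ∑ j, jacInv S.T x j i * (jac S.T x l j * fderiv ℝ φ (S.T x) (Pi.single l 1) i)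
      = ∑ l, (∑ j, jac S.T x l j * jacInv S.T x j i) * fderiv ℝ φ (S.T x) (Pi.single l 1) i := by
        refine Finset.sum_congr rfl fun l _ => ?_
        rw [Finset.sum_mul]
        exact Finset.sum_congr rfl fun j _ => by ring
    _ = fderiv ℝ φ (S.T x) (Pi.single i 1) i := by simp [h1]

theorem continuousOn_jacDj (j i i' : Fin d) :
    ContinuousOn (fun z => jacDj S.T j z i i') S.Ω := by
  have : ContinuousOn (fun x => fderiv ℝ (fun z => jacInv S.T z i i') x (Pi.single j 1)) S.Ω :=
    fun x hx => (((S.contDiffAt_jacInv hx i i').fderiv_right (m := 0) (by norm_num)).clm_apply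
      contDiffAt_const).continuousAt.continuousWithinAt
  exact this.congr fun x hx => S.jacDj_eq hx j i i'

theorem continuousOn_matNorm_jacDj (j : Fin d) :
    ContinuousOn (fun z => matNorm (jacDj S.T j z)) S.Ω := by
  unfold matNorm
  refine NNReal.continuous_coe.comp_continuousOn (ContinuousOn.finset_sup_apply (s := Finset.univ)
    (f := fun i z => ∑ i', ‖jacDj S.T j z i i'‖₊) fun i _ => ?_)
  exact continuousOn_finsetSum _ fun i' _ => (S.continuousOn_jacDj j i i').nnnorm

theorem continuousOn_fluxDist {φ : (Fin d → ℝ) → (Fin d → ℝ)} (hφ : ContDiff ℝ 1 φ) (j : Fin d) :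
    ContinuousOn (fluxDist S.T φ j) S.Ω :=
  continuousOn_finsetSum _ fun i _ => (S.continuousOn_jacDj j j i).mul
    (((continuous_apply i).comp hφ.continuous).comp_continuousOn S.continuousOn_T)

theorem integrableOn_fluxMain {φ : (Fin d → ℝ) → (Fin d → ℝ)} (hφ : ContDiff ℝ 1 φ)
    (hφs : HasCompactSupport φ) (j : Fin d) :
    IntegrableOn (fluxMain S.T φ j) S.Ω := by
  unfold fluxMain
  simp only [Finset.mul_sum]
  refine integrable_finsetSum _ fun i _ => integrable_finsetSum _ fun l _ => ?_
  have h : Continuous fun z => fderiv ℝ φ z (Pi.single l 1) i :=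
    (continuous_apply i).comp ((hφ.continuous_fderiv (by norm_num)).clm_apply continuous_const)
  obtain ⟨M, hM⟩ := (hφs.fderiv (𝕜 := ℝ)).exists_bound_of_continuous
    (hφ.continuous_fderiv (by norm_num))
  have := (S.h5 i j l).mul_bdd (c := M * ‖(Pi.single l 1 : Fin d → ℝ)‖)
    (g := fun x => fderiv ℝ φ (S.T x) (Pi.single l 1) i)
    ((h.comp_continuousOn S.continuousOn_T).aestronglyMeasurable S.Ω_open.measurableSet)
    (ae_of_all _ fun x => (norm_le_pi_norm _ i).trans
      ((ContinuousLinearMap.le_opNorm _ _).trans (by gcongr; exact hM _)))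
  exact this.congr (ae_of_all _ fun x => by ring)

end PES

theorem lintegral_le_of_slices {d : ℕ} (j : Fin d) {F G : (Fin d → ℝ) → ℝ≥0∞}
    (hF : AEMeasurable F) (hG : AEMeasurable G)
    (h : ∀ x, ∫⁻ y, F (Function.update x j y) ≤ ∫⁻ y, G (Function.update x j y)) :
    ∫⁻ x, F x ≤ ∫⁻ x, G x := by
  obtain _ | n := d
  · exact j.elim0
  have key : ∀ H : (Fin (n + 1) → ℝ) → ℝ≥0∞, AEMeasurable H →
      ∫⁻ x, H x = ∫⁻ z : Fin n → ℝ, ∫⁻ y, H (Function.update (j.insertNth 0 z) j y) := by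
    intro H hH
    have hem := (volume_preserving_piFinSuccAbove (fun _ : Fin (n + 1) => ℝ) j).symm
    rw [← hem.map_eq] at hH
    rw [← hem.lintegral_comp_emb (MeasurableEquiv.measurableEmbedding _), Measure.volume_eq_prod]
    refine (lintegral_prod_symm _ (hH.comp_aemeasurable hem.aemeasurable)).trans ?_
    simp only [Fin.update_insertNth]
    rfl
  rw [key F hF, key G hG]
  exact lintegral_mono fun z => h _

theorem enorm_integral_le_of_slices {d : ℕ} (j : Fin d) {F : (Fin d → ℝ) → ℝ}
    {G : (Fin d → ℝ) → ℝ≥0∞} (hF : Integrable F) (hG : AEMeasurable G)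
    (h : ∀ x, Integrable (fun y => F (Function.update x j y)) →
      ‖∫ y, F (Function.update x j y)‖ₑ ≤ ∫⁻ y, G (Function.update x j y)) :
    ‖∫ x, F x‖ₑ ≤ ∫⁻ x, G x := by
  obtain _ | n := d
  · exact j.elim0
  have hem := (volume_preserving_piFinSuccAbove (fun _ : Fin (n + 1) => ℝ) j).symm
  have hemb := (MeasurableEquiv.piFinSuccAbove (fun _ : Fin (n + 1) => ℝ) j).symm.measurableEmbedding
  have hF' := (hem.integrable_comp_emb hemb).2 hF
  rw [← hem.map_eq] at hG
  rw [← hem.integral_comp hemb, ← hem.lintegral_comp_emb hemb]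
  rw [Measure.volume_eq_prod] at hF' ⊢
  refine (congrArg _ (integral_prod_symm _ hF')).trans_le <| le_trans ?_
    (lintegral_prod_symm _ (hG.comp_aemeasurable hem.aemeasurable)).ge
  refine (enorm_integral_le_lintegral_enorm _).trans (lintegral_mono_ae ?_)
  filter_upwards [hF'.prod_left_ae] with z hz
  have := h (j.insertNth 0 z)
  simp only [Fin.update_insertNth] at this
  exact this hz

theorem contDiff_slice {d : ℕ} {h : (Fin d → ℝ) → ℝ} (hh : ContDiff ℝ 1 h) (x : Fin d → ℝ)
    (j : Fin d) : ContDiff ℝ 1 fun y => h (Function.update x j y) :=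
  hh.comp (contDiff_update 1 x j)

theorem hasCompactSupport_slice {d : ℕ} {h : (Fin d → ℝ) → ℝ} (hs : HasCompactSupport h)
    (x : Fin d → ℝ) (j : Fin d) : HasCompactSupport fun y => h (Function.update x j y) :=
  hs.comp_isClosedEmbedding (isClosedEmbedding_update x j)

theorem deriv_slice {d : ℕ} {h : (Fin d → ℝ) → ℝ} (hh : ContDiff ℝ 1 h) (x : Fin d → ℝ)
    (j : Fin d) (y : ℝ) : deriv (fun y => h (Function.update x j y)) y =
      fderiv ℝ h (Function.update x j y) (Pi.single j 1) :=
  ((((hh.differentiable (by norm_num)) _).hasFDerivAt).comp_hasDerivAt y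
    (hasDerivAt_update x j y)).deriv

theorem measurable_indicator_of_continuousOn {X : Type*} [TopologicalSpace X] [MeasurableSpace X]
    [BorelSpace X] {E : Type*} [TopologicalSpace E] [MeasurableSpace E] [BorelSpace E] [Zero E]
    {s : Set X} (hs : MeasurableSet s) {f : X → E} (hf : ContinuousOn f s) :
    Measurable (s.indicator f) := by
  rw [← piecewise_eq_indicator]
  exact hf.measurable_piecewise continuousOn_const hs

theorem isClosed_innerPart {d : ℕ} {U : Set (Fin d → ℝ)} (hU : IsOpen U) {ε : ℝ} (hε : 0 < ε) :
    IsClosed (innerPart U ε) := by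
  have : innerPart U ε = closure U ∩ {x | ε ≤ Metric.infDist x (frontier U)} := by
    ext x
    refine ⟨fun hx => ⟨subset_closure hx.1, hx.2⟩, fun hx => ⟨?_, hx.2⟩⟩
    by_contra hxU
    have hxf : x ∈ frontier U := by rw [hU.frontier_eq]; exact ⟨hx.1, hxU⟩
    have := hx.2
    rw [mem_ofPred_eq, Metric.infDist_zero_of_mem hxf] at this
    linarith
  rw [this]
  exact isClosed_closure.inter
    (isClosed_le continuous_const (Metric.continuous_infDist_pt _))

theorem ball_subset_of_mem_innerPart {d : ℕ} {U : Set (Fin d → ℝ)} {ε : ℝ} (hε : 0 < ε)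
    {x : Fin d → ℝ} (hx : x ∈ innerPart U ε) : Metric.ball x ε ⊆ U := by
  have hU : U ≠ univ := by
    rintro rfl
    have := hx.2
    simp at this
    linarith
  intro y hy
  by_contra hyU
  obtain ⟨z, hz, hzd⟩ := exists_mem_frontier_infDist_compl_eq_dist hx.1 hU
  have h1 : Metric.infDist x Uᶜ ≤ dist x y := Metric.infDist_le_dist_of_mem hyU
  have h2 : Metric.infDist x (frontier U) ≤ dist x z := Metric.infDist_le_dist_of_mem hz
  have h3 := hx.2
  rw [Metric.mem_ball, dist_comm] at hy
  linarith

theorem bLayer_subset {d : ℕ} (U : Set (Fin d → ℝ)) (ε : ℝ) : bLayer U ε ⊆ U := sdiff_subset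

theorem measurableSet_bLayer {d : ℕ} {U : Set (Fin d → ℝ)} (hU : IsOpen U) (ε : ℝ) :
    MeasurableSet (bLayer U ε) :=
  hU.measurableSet.diff (hU.measurableSet.inter
    (isClosed_le continuous_const (Metric.continuous_infDist_pt _)).measurableSet)

namespace PES

variable {d : ℕ} (S : PES d)

theorem finite_innerPart_nonempty {ε : ℝ} (hε : 0 < ε) :
    {k | (innerPart (S.parts k) ε).Nonempty}.Finite := by
  have hfin : volume (⋃ k, S.parts k) ≠ ∞ := by
    rw [S.parts_union]
    exact ((measure_mono S.Ω_subset).trans_lt isCompact_Icc.measure_lt_top).ne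
  refine (Measure.finite_const_le_meas_of_disjoint_iUnion volume
    (Metric.measure_ball_pos volume (0 : Fin d → ℝ) hε)
    (fun k => (S.parts_open k).measurableSet) S.parts_disj hfin).subset ?_
  rintro k ⟨x, hx⟩
  rw [mem_ofPred_eq, Measure.addHaar_ball_center volume x ε |>.symm]
  exact measure_mono (ball_subset_of_mem_innerPart hε hx)

theorem exists_inner_bound {ε : ℝ} (hε : 0 < ε) : ∃ B : ℝ≥0, ∀ j k, ∀ x ∈ innerPart (S.parts k) ε,
    ENNReal.ofReal (matNorm (jacDj S.T j x)) ≤ B := by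
  have h1 : ∀ j k, ∃ M : ℝ≥0, ∀ x ∈ innerPart (S.parts k) ε,
      ENNReal.ofReal (matNorm (jacDj S.T j x)) ≤ M := by
    intro j k
    have hsub : innerPart (S.parts k) ε ⊆ S.Ω := fun x hx => S.parts_subset k hx.1
    have hcpt : IsCompact (innerPart (S.parts k) ε) :=
      isCompact_Icc.of_isClosed_subset (isClosed_innerPart (S.parts_open k) hε)
        (hsub.trans S.Ω_subset)
    obtain ⟨M, hM⟩ := hcpt.exists_bound_of_continuousOn ((S.continuousOn_matNorm_jacDj j).mono hsub)
    exact ⟨M.toNNReal, fun x hx => ENNReal.ofReal_le_ofReal ((le_abs_self _).trans (hM x hx))⟩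
  choose M hM using h1
  set s := (S.finite_innerPart_nonempty hε).toFinset
  refine ⟨∑ j, ∑ k ∈ s, M j k, fun j k x hx => (hM j k x hx).trans ?_⟩
  have hk : k ∈ s := by simpa [s] using ⟨x, hx⟩
  exact_mod_cast (Finset.single_le_sum (f := fun k => M j k) (fun _ _ => zero_le) hk).trans
    (Finset.single_le_sum (f := fun j => ∑ k ∈ s, M j k) (fun _ _ => zero_le) (Finset.mem_univ j))

theorem update_mem_Icc {x : Fin d → ℝ} {j : Fin d} {y : ℝ} (h : Function.update x j y ∈ S.Ω) :
    y ∈ Icc (0 : ℝ) 1 := by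
  have := S.Ω_subset h
  have h0 := this.1 j
  have h1 := this.2 j
  simp at h0 h1
  exact ⟨h0, h1⟩

theorem exists_layer_small {η : ℝ≥0∞} (hη : 0 < η) : ∃ ε > (0 : ℝ), ∀ j (x : Fin d → ℝ),
    (∑' k, ∫⁻ y, (bLayer (S.parts k) ε).indicator
      (fun z => ENNReal.ofReal (matNorm (jacDj S.T j z))) (Function.update x j y)) ≤ η := by
  have h : ∀ᶠ ε in 𝓝[>] (0 : ℝ), ∀ j, (⨆ x : Fin d → ℝ, ∑' k : ℕ, ∫⁻ y in Set.Icc (0:ℝ) 1,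
        Set.indicator (bLayer (S.parts k) ε)
          (fun z => ENNReal.ofReal (matNorm (jacDj S.T j z)))
          (Function.update x j y)) ≤ η :=
    eventually_all.2 fun j => ENNReal.tendsto_nhds_zero.1 (S.h4 j) η hη
  obtain ⟨ε, hε, hpos⟩ := (h.and self_mem_nhdsWithin).exists
  refine ⟨ε, hpos, fun j x => le_trans (le_of_eq ?_) ((le_iSup _ x).trans (hε j))⟩
  refine tsum_congr fun k => ?_
  rw [setLIntegral_eq_of_support_subset]
  intro y hy
  by_contra hy'
  refine hy (indicator_of_notMem (fun hmem => hy' ?_) _)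
  exact S.update_mem_Icc (S.parts_subset k (bLayer_subset _ _ hmem))

theorem exists_distortion_bound {η : ℝ≥0∞} (hη : 0 < η) : ∃ B : ℝ≥0, ∀ j (h : (Fin d → ℝ) → ℝ),
    ContDiff ℝ 1 h → HasCompactSupport h →
    ∫⁻ x in S.Ω, ‖h x‖ₑ * ENNReal.ofReal (matNorm (jacDj S.T j x)) ≤
      η * (∫⁻ x, ‖fderiv ℝ h x (Pi.single j 1)‖ₑ) + B * ∫⁻ x, ‖h x‖ₑ := by
  obtain ⟨ε, hε, hlayer⟩ := S.exists_layer_small hη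
  obtain ⟨B, hB⟩ := S.exists_inner_bound hε
  refine ⟨B, fun j h hh hs => ?_⟩
  set N : (Fin d → ℝ) → ℝ≥0∞ := fun x => ENNReal.ofReal (matNorm (jacDj S.T j x))
  have hN : ∀ k, Measurable ((bLayer (S.parts k) ε).indicator N) := fun k =>
    measurable_indicator_of_continuousOn (measurableSet_bLayer (S.parts_open k) ε)
      (ENNReal.continuous_ofReal.comp_continuousOn ((S.continuousOn_matNorm_jacDj j).mono
        ((bLayer_subset _ _).trans (S.parts_subset k))))
  have hhm : Measurable fun x => ‖h x‖ₑ := hh.continuous.enorm.measurable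
  have hdm : Measurable fun x => ‖fderiv ℝ h x (Pi.single j 1)‖ₑ :=
    ((hh.continuous_fderiv (by norm_num)).clm_apply continuous_const).enorm.measurable
  have hpt : ∀ x ∈ S.Ω, ‖h x‖ₑ * N x ≤
      ‖h x‖ₑ * (∑' k, (bLayer (S.parts k) ε).indicator N x) + B * ‖h x‖ₑ := by
    intro x hx
    obtain ⟨k, hk⟩ := S.exists_mem_parts hx
    by_cases hin : x ∈ innerPart (S.parts k) ε
    · refine le_add_left ?_
      rw [mul_comm]
      gcongr
      exact hB j k x hin
    · refine le_add_right ?_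
      gcongr
      refine le_trans ?_ (ENNReal.le_tsum k)
      rw [indicator_of_mem (show x ∈ bLayer (S.parts k) ε from ⟨hk, hin⟩)]
  calc ∫⁻ x in S.Ω, ‖h x‖ₑ * N x
      ≤ ∫⁻ x in S.Ω, (‖h x‖ₑ * (∑' k, (bLayer (S.parts k) ε).indicator N x) + B * ‖h x‖ₑ) :=
        setLIntegral_mono' S.Ω_open.measurableSet hpt
    _ ≤ ∫⁻ x, (‖h x‖ₑ * (∑' k, (bLayer (S.parts k) ε).indicator N x) + B * ‖h x‖ₑ) :=
        setLIntegral_le_lintegral _ _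
    _ = (∫⁻ x, ‖h x‖ₑ * (∑' k, (bLayer (S.parts k) ε).indicator N x)) + B * ∫⁻ x, ‖h x‖ₑ := by
        rw [lintegral_add_right _ (hhm.const_mul _), lintegral_const_mul _ hhm]
    _ ≤ _ := by
        gcongr
        rw [← lintegral_const_mul _ hdm]
        refine lintegral_le_of_slices j
          (hhm.mul (Measurable.tsum hN)).aemeasurable (hdm.const_mul _).aemeasurable
          fun x => ?_
        have hdm' : Measurable fun y => ‖fderiv ℝ h (Function.update x j y) (Pi.single j 1)‖ₑ :=
          hdm.comp (measurable_update x)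
        have hN' : ∀ k, Measurable fun y => (bLayer (S.parts k) ε).indicator N
            (Function.update x j y) := fun k => (hN k).comp (measurable_update x)
        rw [lintegral_const_mul _ hdm']
        calc ∫⁻ y, ‖h (Function.update x j y)‖ₑ *
              (∑' k, (bLayer (S.parts k) ε).indicator N (Function.update x j y))
            ≤ ∫⁻ y, (∫⁻ t, ‖fderiv ℝ h (Function.update x j t) (Pi.single j 1)‖ₑ) *
              (∑' k, (bLayer (S.parts k) ε).indicator N (Function.update x j y)) := by
              refine lintegral_mono fun y => ?_
              gcongr
              have := enorm_le_lintegral_enorm_deriv (contDiff_slice hh x j)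
                (hasCompactSupport_slice hs x j) y
              simpa only [deriv_slice hh] using this
          _ = (∫⁻ t, ‖fderiv ℝ h (Function.update x j t) (Pi.single j 1)‖ₑ) *
              ∑' k, ∫⁻ y, (bLayer (S.parts k) ε).indicator N (Function.update x j y) := by
              rw [lintegral_const_mul _ (Measurable.tsum hN'),
                lintegral_tsum fun k => (hN' k).aemeasurable]
          _ ≤ η * ∫⁻ t, ‖fderiv ℝ h (Function.update x j t) (Pi.single j 1)‖ₑ := by
              rw [mul_comm]
              gcongr
              exact hlayer j x

end PES

namespace PES

variable {d : ℕ} (S : PES d)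

theorem update_mem_parts_iff {j : Fin d} {x : Fin d → ℝ} {k : ℕ} {y : ℝ} :
    Function.update x j y ∈ S.parts k ↔ ∃ l, y ∈ S.Ifam j x k l := by
  have := Set.ext_iff.1 (S.Ifam_union j x k) y
  simpa using this

theorem tsum_slice_le {j : Fin d} {x : Fin d → ℝ} (hx : ∀ i, i ≠ j → x i ∈ Icc (0 : ℝ) 1)
    {c : ℝ} (hc : c ∈ Icc (0 : ℝ) 1) :
    (∑' p : ℕ × ℕ, if (Icc (c - S.δ) (c + S.δ) ∩ S.Ifam j x p.1 p.2).Nonempty then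
        ⨆ y ∈ S.Ifam j x p.1 p.2, ENNReal.ofReal (matNorm (jacInv S.T (Function.update x j y)))
      else 0) ≤ ENNReal.ofReal S.lam⁻¹ := by
  have hmem : Function.update x j c ∈ Icc (0 : Fin d → ℝ) 1 := by
    rw [mem_Icc, Pi.le_def, Pi.le_def]
    refine ⟨fun i => ?_, fun i => ?_⟩ <;> by_cases hi : i = j
    · subst hi; simpa using hc.1
    · simpa [hi] using (hx i hi).1
    · subst hi; simpa using hc.2
    · simpa [hi] using (hx i hi).2
  have hI : ∀ k l, S.Ifam j (Function.update x j c) k l = S.Ifam j x k l := fun k l =>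
    S.Ifam_indep j _ _ k l fun i hi => by simp [hi]
  simpa only [hI, Function.update_self, Function.update_idem] using S.h3 _ hmem j

theorem exists_flux_bound : ∃ K : ℝ≥0, ∀ j (h : (Fin d → ℝ) → ℝ) (φ : (Fin d → ℝ) → (Fin d → ℝ)),
    ContDiff ℝ 1 h → HasCompactSupport h → IsTest d φ →
    IntegrableOn (fun x => h x * (fluxMain S.T φ j x + fluxDist S.T φ j x)) S.Ω →
    ‖∫ x in S.Ω, h x * (fluxMain S.T φ j x + fluxDist S.T φ j x)‖ₑ ≤
      ENNReal.ofReal S.lam⁻¹ *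
        ((∫⁻ x, ‖fderiv ℝ h x (Pi.single j 1)‖ₑ) + K * ∫⁻ x, ‖h x‖ₑ) := by
  obtain ⟨K, hK⟩ := exists_slice_estimate S.δ_pos
  refine ⟨K, fun j h φ hh hs hφ hint => ?_⟩
  set V : (Fin d → ℝ) → ℝ := S.Ω.indicator fun x => fluxMain S.T φ j x + fluxDist S.T φ j x
    with hV
  have hVeq : S.Ω.indicator (fun x => h x * (fluxMain S.T φ j x + fluxDist S.T φ j x)) =
      fun x => h x * V x := by
    ext x
    by_cases hx : x ∈ S.Ω <;> simp [V, hx]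
  rw [← integrable_indicator_iff S.Ω_open.measurableSet, hVeq] at hint
  rw [← integral_indicator S.Ω_open.measurableSet, hVeq]
  have hhm : Measurable fun x => ‖h x‖ₑ := hh.continuous.enorm.measurable
  have hdm : Measurable fun x => ‖fderiv ℝ h x (Pi.single j 1)‖ₑ :=
    ((hh.continuous_fderiv (by norm_num)).clm_apply continuous_const).enorm.measurable
  have hsm : Measurable fun x => ‖fderiv ℝ h x (Pi.single j 1)‖ₑ + K * ‖h x‖ₑ :=
    hdm.add (hhm.const_mul _)
  rw [← lintegral_const_mul _ hhm, ← lintegral_add_left hdm, ← lintegral_const_mul _ hsm]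
  refine enorm_integral_le_of_slices j hint
    (hsm.const_mul _).aemeasurable fun x hxint => ?_
  by_cases hx : ∀ i, i ≠ j → x i ∈ Icc (0 : ℝ) 1
  swap
  · have hzero : ∀ y, V (Function.update x j y) = 0 := by
      intro y
      refine indicator_of_notMem (fun hmem => hx fun i hi => ?_) _
      have := S.Ω_subset hmem
      have h0 := this.1 i
      have h1 := this.2 i
      simp [hi] at h0 h1
      exact ⟨h0, h1⟩
    simp [hzero]
  have hmemΩ : ∀ p : ℕ × ℕ, ∀ y ∈ S.Ifam j x p.1 p.2, Function.update x j y ∈ S.Ω := fun p y hy =>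
    S.parts_subset p.1 (S.update_mem_parts_iff.2 ⟨p.2, hy⟩)
  have hslice := hK (ENNReal.ofReal S.lam⁻¹) (fun p => S.Ifam j x p.1 p.2)
    (fun p => ⨆ y ∈ S.Ifam j x p.1 p.2,
      ENNReal.ofReal (matNorm (jacInv S.T (Function.update x j y))))
    (fun y => h (Function.update x j y)) (fun y => flux S.T φ j (Function.update x j y))
    (fun y => V (Function.update x j y)) ENNReal.ofReal_ne_top
    (fun p => S.Ifam_open j x _ _) (fun p => S.Ifam_conn j x _ _)
    (fun p y hy => S.update_mem_Icc (hmemΩ p y hy))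
    (fun p q hpq => ?_) (fun c hc => S.tsum_slice_le hx hc)
    (contDiff_slice hh x j) (hasCompactSupport_slice hs x j)
    (fun p y hy => ?_) (fun p y hy => ?_) (fun y hy => ?_) hxint
  · have hhm' : Measurable fun y => ‖h (Function.update x j y)‖ₑ := hhm.comp (measurable_update x)
    have hdm' : Measurable fun y => ‖fderiv ℝ h (Function.update x j y) (Pi.single j 1)‖ₑ :=
      hdm.comp (measurable_update x)
    have hsm' : Measurable fun y => ‖fderiv ℝ h (Function.update x j y) (Pi.single j 1)‖ₑ +
        K * ‖h (Function.update x j y)‖ₑ := hdm'.add (hhm'.const_mul _)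
    rw [lintegral_const_mul _ hsm', lintegral_add_left hdm',
      lintegral_const_mul _ hhm']
    simpa only [deriv_slice hh] using hslice
  · rw [Function.onFun, Set.disjoint_left]
    intro y hyp hyq
    obtain ⟨k, l⟩ := p
    obtain ⟨k', l'⟩ := q
    have hk : k = k' := S.eq_of_mem_parts (S.update_mem_parts_iff.2 ⟨l, hyp⟩)
      (S.update_mem_parts_iff.2 ⟨l', hyq⟩)
    subst hk
    have hl : l ≠ l' := fun h => hpq (by rw [h])
    exact Set.disjoint_left.1 (S.Ifam_disj j x k hl) hyp hyq
  · have := S.hasDerivAt_flux hφ.1 (hmemΩ p y hy) j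
    simpa [V, hmemΩ p y hy] using this
  · exact (ENNReal.ofReal_le_ofReal (abs_sum_row_mul_le _ (hφ.2.2 _) j)).trans
      (le_iSup₂ (f := fun y _ => ENNReal.ofReal (matNorm (jacInv S.T (Function.update x j y)))) y hy)
  · refine indicator_of_notMem (fun hmem => ?_) _
    obtain ⟨k, hk⟩ := S.exists_mem_parts hmem
    obtain ⟨l, hl⟩ := S.update_mem_parts_iff.1 hk
    exact hy (k, l) hl

theorem exists_smooth_lasota_yorke : ∃ θ < (1 : ℝ≥0∞), ∃ B ≠ ∞,
    ∀ (h : (Fin d → ℝ) → ℝ) (φ : (Fin d → ℝ) → (Fin d → ℝ)),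
    ContDiff ℝ 1 h → HasCompactSupport h → IsTest d φ →
    ‖∫ x in S.Ω, h x * divg φ (S.T x)‖ₑ ≤
      θ * (∑ j, ∫⁻ x, ‖fderiv ℝ h x (Pi.single j 1)‖ₑ) + B * ∫⁻ x, ‖h x‖ₑ := by
  have hlam : ENNReal.ofReal S.lam⁻¹ < 1 := by
    rw [← ENNReal.ofReal_one, ENNReal.ofReal_lt_ofReal_iff one_pos]
    exact inv_lt_one_of_one_lt₀ S.lam_gt_one
  obtain ⟨η, hη, hlt⟩ := ENNReal.lt_iff_exists_add_pos_lt.1 hlam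
  obtain ⟨K, hK⟩ := S.exists_flux_bound
  obtain ⟨B, hB⟩ := S.exists_distortion_bound (η := η) (by exact_mod_cast hη)
  set θ := ENNReal.ofReal S.lam⁻¹ + η
  refine ⟨θ, hlt, d * (ENNReal.ofReal S.lam⁻¹ * K + B), by finiteness,
    fun h φ hh hs hφ => ?_⟩
  obtain ⟨M, hM⟩ := hs.exists_bound_of_continuous hh.continuous
  have hmain : ∀ j, IntegrableOn (fun x => h x * fluxMain S.T φ j x) S.Ω := fun j =>
    (S.integrableOn_fluxMain hφ.1 hφ.2.1 j).bdd_mul (c := M)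
      hh.continuous.aestronglyMeasurable (ae_of_all _ hM)
  have hdle : ∀ j x, ‖h x * fluxDist S.T φ j x‖ₑ ≤
      ‖h x‖ₑ * ENNReal.ofReal (matNorm (jacDj S.T j x)) := by
    intro j x
    rw [enorm_mul, Real.enorm_eq_ofReal_abs (fluxDist S.T φ j x)]
    gcongr
    exact abs_sum_row_mul_le _ (hφ.2.2 _) j
  have hgrad : ∀ j, ∫⁻ x, ‖fderiv ℝ h x (Pi.single j 1)‖ₑ ≠ ∞ := fun j =>
    (((hh.continuous_fderiv (by norm_num)).clm_apply
      continuous_const).integrable_of_hasCompactSupport (hs.fderiv_apply (𝕜 := ℝ) _)).2.ne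
  have hfin : ∫⁻ x, ‖h x‖ₑ ≠ ∞ := (hh.continuous.integrable_of_hasCompactSupport hs).2.ne
  have hdist_le : ∀ j, ∫⁻ x in S.Ω, ‖h x * fluxDist S.T φ j x‖ₑ ≤
      η * (∫⁻ x, ‖fderiv ℝ h x (Pi.single j 1)‖ₑ) + B * ∫⁻ x, ‖h x‖ₑ := fun j =>
    (lintegral_mono (hdle j)).trans (hB j h hh hs)
  have hdist : ∀ j, IntegrableOn (fun x => h x * fluxDist S.T φ j x) S.Ω := fun j =>
    ⟨(hh.continuous.continuousOn.mul (S.continuousOn_fluxDist hφ.1 j)).aestronglyMeasurable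
      S.Ω_open.measurableSet, (hdist_le j).trans_lt (by
        have := hgrad j
        finiteness)⟩
  have hsum : ∀ j, IntegrableOn
      (fun x => h x * (fluxMain S.T φ j x + fluxDist S.T φ j x)) S.Ω := fun j =>
    ((hmain j).add (hdist j)).congr (ae_of_all _ fun x => (mul_add _ _ _).symm)
  have hone : ∀ j, ‖∫ x in S.Ω, h x * fluxMain S.T φ j x‖ₑ ≤
      θ * (∫⁻ x, ‖fderiv ℝ h x (Pi.single j 1)‖ₑ) +
        (ENNReal.ofReal S.lam⁻¹ * K + B) * ∫⁻ x, ‖h x‖ₑ := by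
    intro j
    have heq : ∫ x in S.Ω, h x * fluxMain S.T φ j x =
        (∫ x in S.Ω, h x * (fluxMain S.T φ j x + fluxDist S.T φ j x)) -
          ∫ x in S.Ω, h x * fluxDist S.T φ j x := by
      rw [← integral_sub (hsum j) (hdist j)]
      exact integral_congr_ae (ae_of_all _ fun x => by ring)
    rw [heq]
    refine (enorm_sub_le).trans ((add_le_add (hK j h φ hh hs hφ (hsum j))
      ((enorm_integral_le_lintegral_enorm _).trans (hdist_le j))).trans_eq ?_)
    ring
  calc ‖∫ x in S.Ω, h x * divg φ (S.T x)‖ₑ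
      = ‖∑ j, ∫ x in S.Ω, h x * fluxMain S.T φ j x‖ₑ := by
        rw [← integral_finsetSum _ fun j _ => hmain j]
        congr 1
        refine setIntegral_congr_fun S.Ω_open.measurableSet fun x hx => ?_
        simp only [← S.sum_fluxMain φ hx, Finset.mul_sum]
    _ ≤ ∑ j, ‖∫ x in S.Ω, h x * fluxMain S.T φ j x‖ₑ := enorm_sum_le _ _
    _ ≤ ∑ j, (θ * (∫⁻ x, ‖fderiv ℝ h x (Pi.single j 1)‖ₑ) +
        (ENNReal.ofReal S.lam⁻¹ * K + B) * ∫⁻ x, ‖h x‖ₑ) := Finset.sum_le_sum fun j _ => hone j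
    _ = _ := by
        rw [Finset.sum_add_distrib, Finset.mul_sum, Finset.sum_const, Finset.card_univ,
          Fintype.card_fin, nsmul_eq_mul, mul_assoc]

end PES

theorem tendsto_integral_abs_sub {X : Type*} [MeasurableSpace X] {μ : Measure X} {f : ℕ → X → ℝ}
    {h : X → ℝ} (hf : ∀ n, Integrable (f n) μ) (hh : Integrable h μ)
    (hle : ∀ n, ∫ x, |f n x| ∂μ ≤ ∫ x, |h x| ∂μ)
    (hlim : ∀ᵐ x ∂μ, Tendsto (fun n => f n x) atTop (𝓝 (h x))) :
    Tendsto (fun n => ∫ x, |f n x - h x| ∂μ) atTop (𝓝 0) := by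
  have hmin : ∀ n, Integrable (fun x => min |h x| |f n x - h x|) μ := fun n =>
    hh.abs.inf ((hf n).sub hh).abs
  have hlim0 : Tendsto (fun n => ∫ x, min |h x| |f n x - h x| ∂μ) atTop (𝓝 0) := by
    have := tendsto_integral_of_dominated_convergence (μ := μ)
      (F := fun n x => min |h x| |f n x - h x|) (f := fun _ => 0) (fun x => |h x|)
      (fun n => (hmin n).1) hh.abs (fun n => ae_of_all _ fun x => ?_) ?_
    · simpa using this
    · rw [Real.norm_eq_abs, abs_of_nonneg (le_min (abs_nonneg _) (abs_nonneg _))]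
      exact min_le_left _ _
    · filter_upwards [hlim] with x hx
      have h1 : Tendsto (fun n => |f n x - h x|) atTop (𝓝 0) := by
        simpa using (hx.sub_const (h x)).abs
      simpa using (tendsto_const_nhds (x := |h x|)).min h1
  refine squeeze_zero (fun n => integral_nonneg fun x => abs_nonneg _) (fun n => ?_)
    (by simpa using hlim0.const_mul 2)
  have hpt : ∀ x, |f n x - h x| ≤ |f n x| - |h x| + 2 * min |h x| |f n x - h x| := by
    intro x
    rcases min_cases |h x| |f n x - h x| with ⟨he, _⟩ | ⟨he, _⟩ <;> rw [he]
    · linarith [abs_sub (f n x) (h x)]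
    · linarith [abs_sub_abs_le_abs_sub (h x) (f n x), abs_sub_comm (h x) (f n x)]
  have hint : Integrable (fun x => |f n x| - |h x|) μ := (hf n).abs.sub hh.abs
  calc ∫ x, |f n x - h x| ∂μ
      ≤ ∫ x, (|f n x| - |h x| + 2 * min |h x| |f n x - h x|) ∂μ :=
        integral_mono ((hf n).sub hh).abs (hint.add ((hmin n).const_mul 2)) hpt
    _ = (∫ x, |f n x| ∂μ) - (∫ x, |h x| ∂μ) + 2 * ∫ x, min |h x| |f n x - h x| ∂μ := by
        rw [integral_add hint ((hmin n).const_mul 2), integral_sub (hf n).abs hh.abs,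
          integral_const_mul]
    _ ≤ 2 * ∫ x, min |h x| |f n x - h x| ∂μ := by linarith [hle n]

theorem continuous_divg {d : ℕ} {φ : (Fin d → ℝ) → (Fin d → ℝ)} (hφ : ContDiff ℝ 1 φ) :
    Continuous (divg φ) :=
  continuous_finsetSum _ fun j _ => (continuous_apply j).comp
    ((hφ.continuous_fderiv (by norm_num)).clm_apply continuous_const)

theorem exists_abs_divg_le {d : ℕ} {φ : (Fin d → ℝ) → (Fin d → ℝ)} (hφ : ContDiff ℝ 1 φ)
    (hs : HasCompactSupport φ) : ∃ M, ∀ x, |divg φ x| ≤ M := by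
  have h : HasCompactSupport (divg φ) := by
    have := (hs.fderiv (𝕜 := ℝ)).comp_left
      (g := fun A : (Fin d → ℝ) →L[ℝ] (Fin d → ℝ) => ∑ j, A (Pi.single j 1) j) (by simp)
    exact this
  exact h.exists_bound_of_continuous (continuous_divg hφ)

theorem IsTest.comp_add_right {d : ℕ} {φ : (Fin d → ℝ) → (Fin d → ℝ)} (hφ : IsTest d φ)
    (t : Fin d → ℝ) : IsTest d fun x => φ (x + t) :=
  ⟨hφ.1.comp (contDiff_id.add contDiff_const),
    hφ.2.1.comp_homeomorph (Homeomorph.addRight t), fun _ => hφ.2.2 _⟩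

theorem divg_comp_add_right {d : ℕ} (φ : (Fin d → ℝ) → (Fin d → ℝ)) (t x : Fin d → ℝ) :
    divg (fun x => φ (x + t)) x = divg φ (x + t) := by
  simp [divg, fderiv_comp_add_right]

theorem ofReal_integral_mul_divg_le {d : ℕ} {φ : (Fin d → ℝ) → (Fin d → ℝ)} (hφ : IsTest d φ)
    (h : (Fin d → ℝ) → ℝ) : ENNReal.ofReal (∫ x, h x * divg φ x) ≤ bvNormE h :=
  le_iSup (fun φ : {φ : (Fin d → ℝ) → (Fin d → ℝ) // IsTest d φ} =>
    ENNReal.ofReal (∫ x, h x * divg φ.1 x)) ⟨φ, hφ⟩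

theorem bvNormE_convolution_le {d : ℕ} {ρ h : (Fin d → ℝ) → ℝ} (hρ0 : ∀ t, 0 ≤ ρ t)
    (hρ : Integrable ρ) (hρ1 : ∫ t, ρ t = 1) (hh : Integrable h) :
    bvNormE (fun x => ∫ t, ρ t * h (x - t)) ≤ bvNormE h := by
  by_cases htop : bvNormE h = ∞
  · rw [htop]; exact le_top
  refine iSup_le fun ⟨φ, hφ⟩ => ?_
  obtain ⟨M, hM⟩ := exists_abs_divg_le hφ.1 hφ.2.1
  have hD := continuous_divg hφ.1
  have hprod : Integrable (fun p : (Fin d → ℝ) × (Fin d → ℝ) =>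
      ρ p.2 * h (p.1 - p.2) * divg φ p.1) (volume.prod volume) := by
    have := (hρ.convolution_integrand (ContinuousLinearMap.lsmul ℝ ℝ) hh).mul_bdd (c := M)
      (g := fun p : (Fin d → ℝ) × (Fin d → ℝ) => divg φ p.1)
      (hD.comp continuous_fst).aestronglyMeasurable (ae_of_all _ fun p => hM p.1)
    simpa using this
  have heq : ∀ t, ∫ x, ρ t * h (x - t) * divg φ x = ρ t * ∫ x, h x * divg φ (x + t) := by
    intro t
    rw [← integral_const_mul, ← integral_sub_right_eq_self (fun x => ρ t * (h x * divg φ (x + t))) t]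
    exact integral_congr_ae (ae_of_all _ fun x => by simp [mul_assoc])
  have hswap : ∫ x, (∫ t, ρ t * h (x - t)) * divg φ x =
      ∫ t, ρ t * ∫ x, h x * divg φ (x + t) := by
    simp_rw [← integral_mul_const, ← heq]
    exact integral_integral_swap hprod
  rw [hswap, ← ENNReal.ofReal_toReal htop]
  refine ENNReal.ofReal_le_ofReal ?_
  have hint : Integrable fun t => ρ t * ∫ x, h x * divg φ (x + t) := by
    simpa only [heq] using hprod.integral_prod_right
  calc ∫ t, ρ t * ∫ x, h x * divg φ (x + t)
      ≤ ∫ t, ρ t * (bvNormE h).toReal := by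
        refine integral_mono hint (hρ.mul_const _) fun t => ?_
        refine mul_le_mul_of_nonneg_left ?_ (hρ0 t)
        rw [← ENNReal.ofReal_le_iff_le_toReal htop]
        simpa only [divg_comp_add_right] using ofReal_integral_mul_divg_le (hφ.comp_add_right t) h
    _ = (bvNormE h).toReal := by rw [integral_mul_const, hρ1, one_mul]

theorem integral_abs_convolution_le {d : ℕ} {ρ h : (Fin d → ℝ) → ℝ} (hρ0 : ∀ t, 0 ≤ ρ t)
    (hρ : Integrable ρ) (hρ1 : ∫ t, ρ t = 1) (hh : Integrable h) :
    ∫ x, |∫ t, ρ t * h (x - t)| ≤ ∫ x, |h x| := by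
  have hprod : Integrable (fun p : (Fin d → ℝ) × (Fin d → ℝ) =>
      |ρ p.2 * h (p.1 - p.2)|) (volume.prod volume) := by
    have := (hρ.convolution_integrand (ContinuousLinearMap.lsmul ℝ ℝ) hh).abs
    simpa using this
  calc ∫ x, |∫ t, ρ t * h (x - t)|
      ≤ ∫ x, ∫ t, |ρ t * h (x - t)| := by
        refine integral_mono_of_nonneg (ae_of_all _ fun x => abs_nonneg _)
          hprod.integral_prod_left (ae_of_all _ fun x => abs_integral_le_integral_abs)
    _ = ∫ t, ∫ x, |ρ t * h (x - t)| := integral_integral_swap hprod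
    _ = ∫ t, ρ t * ∫ x, |h x| := by
        refine integral_congr_ae (ae_of_all _ fun t => ?_)
        simp only [abs_mul, abs_of_nonneg (hρ0 t), integral_const_mul]
        rw [integral_sub_right_eq_self (fun x => |h x|) t]
    _ = ∫ x, |h x| := by rw [integral_mul_const, hρ1, one_mul]

theorem sum_lintegral_fderiv_le_bvNormE {d : ℕ} {g : (Fin d → ℝ) → ℝ} (hg : ContDiff ℝ 2 g)
    (hs : HasCompactSupport g) :
    ∑ j, ∫⁻ x, ‖fderiv ℝ g x (Pi.single j 1)‖ₑ ≤ bvNormE g := by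
  set w : Fin d → (Fin d → ℝ) → ℝ := fun j x => fderiv ℝ g x (Pi.single j 1) with hw
  have hfd : ContDiff ℝ 1 (fderiv ℝ g) := hg.fderiv_right (by norm_num)
  have hwd : ∀ j, ContDiff ℝ 1 (w j) := fun j => hfd.clm_apply contDiff_const
  have hws : ∀ j, HasCompactSupport (w j) := fun j => hs.fderiv_apply (𝕜 := ℝ) _
  have hwi : ∀ j, Integrable (w j) := fun j =>
    (hwd j).continuous.integrable_of_hasCompactSupport (hws j)
  set c : ℕ → ℝ := fun n => 1 / ((n : ℝ) + 1) with hc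
  have hcpos : ∀ n, 0 < c n := fun n => by positivity
  have hsq : ∀ n (a : ℝ), 0 < √(a ^ 2 + c n ^ 2) := fun n a =>
    Real.sqrt_pos.2 (by have := hcpos n; positivity)
  have hle : ∀ n (a : ℝ), |a| ≤ √(a ^ 2 + c n ^ 2) := fun n a =>
    Real.abs_le_sqrt (by have := hcpos n; nlinarith)
  set φ : ℕ → (Fin d → ℝ) → (Fin d → ℝ) := fun n x j => -(w j x / √(w j x ^ 2 + c n ^ 2)) with hφdef
  have hφj : ∀ n j, ContDiff ℝ 1 fun x => φ n x j := fun n j =>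
    ((hwd j).div ((((hwd j).pow 2).add contDiff_const).sqrt fun x => by
      have := hcpos n; positivity) fun x => (hsq n _).ne').neg
  have hφ1 : ∀ n x j, |φ n x j| ≤ 1 := by
    intro n x j
    rw [hφdef, abs_neg, abs_div, abs_of_pos (hsq n _), div_le_one (hsq n _)]
    exact hle n _
  have hφ : ∀ n, IsTest d (φ n) := fun n => by
    refine ⟨contDiff_pi.2 (hφj n), ?_, fun x => (pi_norm_le_iff_of_nonneg zero_le_one).2 (hφ1 n x)⟩
    exact (hs.fderiv (𝕜 := ℝ)).comp_left (g := fun A : (Fin d → ℝ) →L[ℝ] ℝ => fun j =>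
      -(A (Pi.single j 1) / √(A (Pi.single j 1) ^ 2 + c n ^ 2))) (by ext; simp)
  have hparts : ∀ n, ∫ x, g x * divg (φ n) x = ∑ j, ∫ x, w j x ^ 2 / √(w j x ^ 2 + c n ^ 2) := by
    intro n
    have hdiv : ∀ x, divg (φ n) x = ∑ j, fderiv ℝ (fun x => φ n x j) x (Pi.single j 1) := by
      intro x
      refine Finset.sum_congr rfl fun j _ => ?_
      have := hasFDerivAt_pi'.1
        (((hφ n).1.differentiable (by norm_num)) x).hasFDerivAt j
      rw [this.fderiv]
      rfl
    have hcont : ∀ j, Continuous fun x => fderiv ℝ (fun x => φ n x j) x (Pi.single j 1) := fun j =>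
      ((hφj n j).continuous_fderiv (by norm_num)).clm_apply continuous_const
    have hi2 : ∀ j, Integrable fun x => g x * fderiv ℝ (fun x => φ n x j) x (Pi.single j 1) :=
      fun j => (hg.continuous.mul (hcont j)).integrable_of_hasCompactSupport hs.mul_right
    simp only [hdiv, Finset.mul_sum]
    rw [integral_finsetSum _ fun j _ => hi2 j]
    refine Finset.sum_congr rfl fun j _ => ?_
    rw [integral_mul_fderiv_eq_neg_fderiv_mul_of_integrable _ (hi2 j)
      ((hg.continuous.mul (hφj n j).continuous).integrable_of_hasCompactSupport hs.mul_right)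
      (fun x _ => (hg.differentiable (by norm_num)) x)
      (fun x _ => ((hφj n j).differentiable (by norm_num)) x), ← integral_neg]
    · refine integral_congr_ae (ae_of_all _ fun x => ?_)
      simp only [hφdef, hw]
      ring
    · exact ((hwd j).continuous.mul (hφj n j).continuous).integrable_of_hasCompactSupport
        (hws j).mul_right
  have hlim : Tendsto (fun n => ∑ j, ∫ x, w j x ^ 2 / √(w j x ^ 2 + c n ^ 2)) atTop
      (𝓝 (∑ j, ∫ x, |w j x|)) := by
    refine tendsto_finsetSum _ fun j _ => ?_
    refine tendsto_integral_of_dominated_convergence (fun x => |w j x|) (fun n => ?_) (hwi j).abs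
      (fun n => ae_of_all _ fun x => ?_) (ae_of_all _ fun x => ?_)
    · have hcont : Continuous fun x => w j x ^ 2 / √(w j x ^ 2 + c n ^ 2) :=
        ((hwd j).continuous.pow 2).div
          (((hwd j).continuous.pow 2).add continuous_const).sqrt fun x => (hsq n _).ne'
      exact hcont.aestronglyMeasurable
    · rw [Real.norm_eq_abs, abs_div, abs_of_pos (hsq n _), div_le_iff₀ (hsq n _), abs_pow, sq]
      exact mul_le_mul_of_nonneg_left (hle n _) (abs_nonneg _)
    · by_cases h0 : w j x = 0
      · simp [h0]
      have hc0 : Tendsto c atTop (𝓝 0) := tendsto_one_div_add_atTop_nhds_zero_nat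
      have h1 : Tendsto (fun n => √(w j x ^ 2 + c n ^ 2)) atTop (𝓝 |w j x|) := by
        have := ((hc0.pow 2).const_add (w j x ^ 2)).sqrt
        simpa [Real.sqrt_sq_eq_abs] using this
      have h2 := (tendsto_const_nhds (x := w j x ^ 2)).div h1 (abs_ne_zero.2 h0)
      have h3 : w j x ^ 2 / |w j x| = |w j x| := by
        rw [div_eq_iff (abs_ne_zero.2 h0), ← sq, sq_abs]
      rwa [h3] at h2
  have hfin : ENNReal.ofReal (∑ j, ∫ x, |w j x|) ≤ bvNormE g := by
    refine le_of_tendsto (ENNReal.tendsto_ofReal hlim) (Eventually.of_forall fun n => ?_)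
    rw [← hparts]
    exact ofReal_integral_mul_divg_le (hφ n) g
  refine le_trans (le_of_eq ?_) hfin
  rw [ENNReal.ofReal_sum_of_nonneg fun j _ => integral_nonneg fun x => abs_nonneg _]
  refine Finset.sum_congr rfl fun j _ => ?_
  rw [ofReal_integral_eq_lintegral_ofReal (hwi j).abs (ae_of_all _ fun x => abs_nonneg _)]
  simp only [Real.enorm_eq_ofReal_abs, hw]

theorem exists_smooth_approx {d : ℕ} {h : (Fin d → ℝ) → ℝ} (hh : Integrable h)
    (hsupp : ∀ x, x ∉ Icc (0 : Fin d → ℝ) 1 → h x = 0) :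
    ∃ g : ℕ → (Fin d → ℝ) → ℝ, (∀ n, ContDiff ℝ 1 (g n)) ∧ (∀ n, HasCompactSupport (g n)) ∧
      (∀ n, ∑ j, ∫⁻ x, ‖fderiv ℝ (g n) x (Pi.single j 1)‖ₑ ≤ bvNormE h) ∧
      Tendsto (fun n => ∫ x, |g n x - h x|) atTop (𝓝 0) := by
  have hpos : ∀ n : ℕ, (0 : ℝ) < 1 / ((n : ℝ) + 1) := fun n => by positivity
  let b : ℕ → ContDiffBump (0 : Fin d → ℝ) := fun n =>
    ⟨1 / ((n : ℝ) + 1), 2 * (1 / ((n : ℝ) + 1)), hpos n, by linarith [hpos n]⟩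
  set ρ : ℕ → (Fin d → ℝ) → ℝ := fun n => (b n).normed volume with hρ
  have hρi : ∀ n, Integrable (ρ n) := fun n => (b n).integrable_normed
  have hρ0 : ∀ n t, 0 ≤ ρ n t := fun n t => (b n).nonneg_normed t
  have hρ1 : ∀ n, ∫ t, ρ n t = 1 := fun n => (b n).integral_normed
  have hconv : ∀ n, (convolution (ρ n) h (ContinuousLinearMap.lsmul ℝ ℝ) volume) =
      fun x => ∫ t, ρ n t * h (x - t) := fun n => by
    ext x; simp [convolution]
  have hhs : HasCompactSupport h := HasCompactSupport.intro isCompact_Icc hsupp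
  have hρs : ∀ n, HasCompactSupport (ρ n) := fun n => (b n).hasCompactSupport_normed
  have hgs : ∀ n, HasCompactSupport fun x => ∫ t, ρ n t * h (x - t) := fun n => by
    rw [← hconv]
    exact (hρs n).convolution _ hhs
  have hgd : ∀ n, ContDiff ℝ 2 fun x => ∫ t, ρ n t * h (x - t) := fun n => by
    rw [← hconv]
    exact (hρs n).contDiff_convolution_left (n := 2) _ (b n).contDiff_normed
      hh.locallyIntegrable
  refine ⟨fun n x => ∫ t, ρ n t * h (x - t), fun n => (hgd n).of_le (by norm_num), hgs,
    fun n => ?_, ?_⟩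
  · exact (sum_lintegral_fderiv_le_bvNormE (hgd n) (hgs n)).trans
      (bvNormE_convolution_le (hρ0 n) (hρi n) (hρ1 n) hh)
  · refine tendsto_integral_abs_sub
      (fun n => (hgd n).continuous.integrable_of_hasCompactSupport (hgs n)) hh
      (fun n => integral_abs_convolution_le (hρ0 n) (hρi n) (hρ1 n) hh) ?_
    have hlim : Tendsto (fun n => (b n).rOut) atTop (𝓝 0) := by
      have := (tendsto_one_div_add_atTop_nhds_zero_nat (𝕜 := ℝ)).const_mul 2
      rwa [mul_zero] at this
    have := ContDiffBump.ae_convolution_tendsto_right_of_locallyIntegrable (μ := volume)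
      (K := 2) hlim (Eventually.of_forall fun n => le_rfl) hh.locallyIntegrable
    filter_upwards [this] with x hx
    exact hx.congr fun n => congrFun (hconv n) x

theorem exists_smooth_approx_lintegral {d : ℕ} {h : (Fin d → ℝ) → ℝ} (hh : Integrable h)
    (hsupp : ∀ x, x ∉ Icc (0 : Fin d → ℝ) 1 → h x = 0) :
    ∃ g : ℕ → (Fin d → ℝ) → ℝ, (∀ n, ContDiff ℝ 1 (g n)) ∧ (∀ n, HasCompactSupport (g n)) ∧
      (∀ n, ∑ j, ∫⁻ x, ‖fderiv ℝ (g n) x (Pi.single j 1)‖ₑ ≤ bvNormE h) ∧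
      Tendsto (fun n => ∫⁻ x, ‖g n x - h x‖ₑ) atTop (𝓝 0) := by
  obtain ⟨g, hg, hgs, hgb, hlim⟩ := exists_smooth_approx hh hsupp
  refine ⟨g, hg, hgs, hgb, ?_⟩
  have := ENNReal.tendsto_ofReal hlim
  rw [ENNReal.ofReal_zero] at this
  refine this.congr fun n => ?_
  have hi : Integrable fun x => |g n x - h x| :=
    (((hg n).continuous.integrable_of_hasCompactSupport (hgs n)).sub hh).abs
  rw [ofReal_integral_eq_lintegral_ofReal hi (ae_of_all _ fun x => abs_nonneg _)]
  simp only [Real.enorm_eq_ofReal_abs]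

theorem lintegral_enorm_le_add {X : Type*} [MeasurableSpace X] {μ : Measure X} {u v : X → ℝ}
    (hv : AEStronglyMeasurable v μ) :
    ∫⁻ x, ‖u x‖ₑ ∂μ ≤ ∫⁻ x, ‖v x‖ₑ ∂μ + ∫⁻ x, ‖v x - u x‖ₑ ∂μ := by
  rw [← lintegral_add_left' hv.enorm]
  refine lintegral_mono fun x => ?_
  calc ‖u x‖ₑ = ‖v x - (v x - u x)‖ₑ := by rw [sub_sub_cancel]
    _ ≤ _ := enorm_sub_le

theorem enorm_fderiv_le_sum {d : ℕ} (A : (Fin d → ℝ) →L[ℝ] ℝ) :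
    ‖A‖ₑ ≤ ∑ j, ‖A (Pi.single j 1)‖ₑ := by
  have h : ‖A‖ ≤ ∑ j, ‖A (Pi.single j 1)‖ := by
    refine A.opNorm_le_bound (Finset.sum_nonneg fun j _ => norm_nonneg _) fun v => ?_
    have hv : A v = ∑ j, v j * A (Pi.single j 1) := by
      conv_lhs => rw [pi_eq_sum_univ' v, map_sum]
      refine Finset.sum_congr rfl fun j _ => ?_
      rw [map_smul, smul_eq_mul]
    rw [hv, Finset.sum_mul]
    refine (norm_sum_le _ _).trans (Finset.sum_le_sum fun j _ => ?_)
    rw [norm_mul, mul_comm]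
    gcongr
    exact norm_le_pi_norm v j
  simp only [← ofReal_norm]
  rw [← ENNReal.ofReal_sum_of_nonneg fun j _ => norm_nonneg _]
  exact ENNReal.ofReal_le_ofReal h

theorem exists_setLIntegral_le_of_contDiff {d : ℕ} (hd : 1 ≤ d) :
    ∃ K : ℝ≥0, ∀ (g : (Fin d → ℝ) → ℝ) (Γ : Set (Fin d → ℝ)), ContDiff ℝ 1 g →
      HasCompactSupport g → ∫⁻ x in Γ, ‖g x‖ₑ ≤
        K * volume Γ ^ (1 / (d : ℝ)) * ∑ j, ∫⁻ x, ‖fderiv ℝ g x (Pi.single j 1)‖ₑ := by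
  rcases hd.eq_or_lt with rfl | hd
  · refine ⟨1, fun g Γ hg hgs => ?_⟩
    have hb : ∀ x, ‖g x‖ₑ ≤ ∫⁻ x, ‖fderiv ℝ g x (Pi.single 0 1)‖ₑ := fun x => by
      have h1 := enorm_le_lintegral_enorm_deriv (contDiff_slice hg x 0)
        (hasCompactSupport_slice hgs x 0) (x 0)
      simp only [deriv_slice hg, Function.update_eq_self] at h1
      refine h1.trans (le_of_eq (Eq.trans ?_
        ((volume_preserving_funUnique (Fin 1) ℝ).symm.lintegral_comp_emb
          (MeasurableEquiv.measurableEmbedding _)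
          fun x => ‖fderiv ℝ g x (Pi.single 0 1)‖ₑ)))
      refine lintegral_congr fun y => ?_
      congr 3
      ext i
      rw [Subsingleton.elim i 0, Function.update_self]
      rfl
    calc ∫⁻ x in Γ, ‖g x‖ₑ ≤ ∫⁻ _ in Γ, ∫⁻ x, ‖fderiv ℝ g x (Pi.single 0 1)‖ₑ :=
          lintegral_mono hb
      _ = _ := by
          rw [setLIntegral_const]
          simp [mul_comm]
  · set p : ℝ≥0 := NNReal.conjExponent d with hp
    have hd1 : (1 : ℝ≥0) < d := by exact_mod_cast hd
    have hpc : NNReal.HolderConjugate d p := NNReal.HolderConjugate.conjExponent hd1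
    have hpe : 1 - 1 / (p : ℝ) = 1 / (d : ℝ) := by
      have h2 : (d : ℝ)⁻¹ + (p : ℝ)⁻¹ = 1 := by
        simpa using congrArg NNReal.toReal hpc.inv_add_inv_eq_one
      rw [one_div, one_div]; linarith
    refine ⟨eLpNormLESNormFDerivOneConst (volume : Measure (Fin d → ℝ)) p, fun g Γ hg hgs => ?_⟩
    have h1 := eLpNorm_le_eLpNorm_fderiv_one (volume : Measure (Fin d → ℝ)) hg hgs (p := p)
      (by simpa using hpc)
    have h2 := eLpNorm_le_eLpNorm_mul_rpow_measure_univ (μ := volume.restrict Γ) (p := 1)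
      (q := p) (by exact_mod_cast hpc.symm.lt.le) hg.continuous.aestronglyMeasurable
    rw [eLpNorm_one_eq_lintegral_enorm] at h1 h2
    simp only [ENNReal.toReal_one, Measure.restrict_apply_univ, ENNReal.coe_toReal, div_one, hpe] at h2
    have h3 : ∫⁻ x, ‖fderiv ℝ g x‖ₑ ≤ ∑ j, ∫⁻ x, ‖fderiv ℝ g x (Pi.single j 1)‖ₑ := by
      rw [← lintegral_finsetSum]
      · exact lintegral_mono fun x => enorm_fderiv_le_sum _
      · intro j _
        exact ((hg.continuous_fderiv one_ne_zero).clm_apply continuous_const).enorm.measurable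
    calc _ ≤ _ := h2
      _ ≤ eLpNorm g p volume * volume Γ ^ (1 / (d : ℝ)) := by
          gcongr
          exact Measure.restrict_le_self
      _ ≤ (eLpNormLESNormFDerivOneConst (volume : Measure (Fin d → ℝ)) p *
            ∑ j, ∫⁻ x, ‖fderiv ℝ g x (Pi.single j 1)‖ₑ) * volume Γ ^ (1 / (d : ℝ)) := by
          gcongr
          exact h1.trans (by gcongr)
      _ = _ := by ring

theorem exists_setLIntegral_le_bvNormE {d : ℕ} (hd : 1 ≤ d) :
    ∃ K : ℝ≥0, ∀ (h : (Fin d → ℝ) → ℝ) (Γ : Set (Fin d → ℝ)), Integrable h →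
      (∀ x, x ∉ Icc (0 : Fin d → ℝ) 1 → h x = 0) →
      ∫⁻ x in Γ, ‖h x‖ₑ ≤ K * volume Γ ^ (1 / (d : ℝ)) * bvNormE h := by
  obtain ⟨K, hK⟩ := exists_setLIntegral_le_of_contDiff hd
  refine ⟨K, fun h Γ hh hsupp => ?_⟩
  obtain ⟨g, hg, hgs, hgb, hlim⟩ := exists_smooth_approx_lintegral hh hsupp
  have := hlim.const_add (K * volume Γ ^ (1 / (d : ℝ)) * bvNormE h)
  rw [add_zero] at this
  refine ge_of_tendsto this (Eventually.of_forall fun n => ?_)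
  refine (lintegral_enorm_le_add (v := g n) (hg n).continuous.aestronglyMeasurable).trans ?_
  gcongr
  · exact (hK _ Γ (hg n) (hgs n)).trans (by gcongr; exact hgb n)
  · exact Measure.restrict_le_self

namespace PES

variable {d : ℕ} (S : PES d)

theorem exists_lasota_yorke : ∃ θ < (1 : ℝ≥0∞), ∃ B ≠ ∞, ∀ h : (Fin d → ℝ) → ℝ, Integrable h →
    (∀ x, x ∉ Icc (0 : Fin d → ℝ) 1 → h x = 0) →
    bvNormE (transferOp S.Ω S.T h) ≤ θ * bvNormE h + B * ∫⁻ x, ‖h x‖ₑ := by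
  obtain ⟨θ, hθ, B, hB, hLY⟩ := S.exists_smooth_lasota_yorke
  refine ⟨θ, hθ, B, hB, fun h hh hsupp => iSup_le fun ⟨φ, hφ⟩ => ?_⟩
  obtain ⟨g, hg, hgs, hgb, hlim⟩ := exists_smooth_approx_lintegral hh hsupp
  obtain ⟨M, hM⟩ := exists_abs_divg_le hφ.1 hφ.2.1
  have hΨ : AEStronglyMeasurable (fun y => divg φ (S.T y)) (volume.restrict S.Ω) :=
    ((continuous_divg hφ.1).comp_continuousOn S.continuousOn_T).aestronglyMeasurable
      S.Ω_open.measurableSet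
  have hgi : ∀ n, Integrable (g n) := fun n =>
    (hg n).continuous.integrable_of_hasCompactSupport (hgs n)
  have hmul : ∀ {u : (Fin d → ℝ) → ℝ}, Integrable u →
      IntegrableOn (fun y => u y * divg φ (S.T y)) S.Ω := fun hu =>
    hu.integrableOn.mul_bdd (c := M) hΨ (ae_of_all _ fun y => hM _)
  set e : ℕ → ℝ≥0∞ := fun n => ∫⁻ x, ‖g n x - h x‖ₑ with he
  have hstep : ∀ n, ENNReal.ofReal (∫ x, transferOp S.Ω S.T h x * divg φ x) ≤
      θ * bvNormE h + B * ((∫⁻ x, ‖h x‖ₑ) + e n) + ENNReal.ofReal M * e n := fun n => by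
    rw [S.integral_transferOp_mul hh.integrableOn (continuous_divg hφ.1) hM]
    refine (ENNReal.ofReal_le_ofReal (le_abs_self _)).trans ?_
    rw [← Real.enorm_eq_ofReal_abs]
    have h1 : ∫ y in S.Ω, h y * divg φ (S.T y) = (∫ y in S.Ω, g n y * divg φ (S.T y)) -
        ∫ y in S.Ω, (g n y - h y) * divg φ (S.T y) := by
      have hi : IntegrableOn (fun y => (g n y - h y) * divg φ (S.T y)) S.Ω :=
        hmul ((hgi n).sub hh)
      rw [← integral_sub (hmul (hgi n)) hi]
      congr 1 with y
      ring
    rw [h1]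
    refine enorm_sub_le.trans (add_le_add
      (b := θ * bvNormE h + B * ((∫⁻ x, ‖h x‖ₑ) + e n)) (d := ENNReal.ofReal M * e n)
      ((hLY _ _ (hg n) (hgs n) hφ).trans ?_) ?_)
    · gcongr
      · exact hgb n
      · refine (lintegral_enorm_le_add (v := h) hh.aestronglyMeasurable).trans ?_
        gcongr
        refine le_of_eq (lintegral_congr fun x => ?_)
        rw [← enorm_neg, neg_sub]
    · refine (enorm_integral_le_lintegral_enorm _).trans ?_
      refine (lintegral_mono' (g := fun y => ENNReal.ofReal M * ‖g n y - h y‖ₑ)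
        Measure.restrict_le_self fun y => ?_).trans
        (lintegral_const_mul' _ _ ENNReal.ofReal_ne_top).le
      change ‖(g n y - h y) * divg φ (S.T y)‖ₑ ≤ ENNReal.ofReal M * ‖g n y - h y‖ₑ
      rw [enorm_mul, mul_comm]
      gcongr
      rw [Real.enorm_eq_ofReal_abs]
      exact ENNReal.ofReal_le_ofReal (hM _)
  have hl : Tendsto (fun n => θ * bvNormE h + B * ((∫⁻ x, ‖h x‖ₑ) + e n) + ENNReal.ofReal M * e n)
      atTop (𝓝 (θ * bvNormE h + B * ((∫⁻ x, ‖h x‖ₑ) + 0) + ENNReal.ofReal M * 0)) :=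
    (((ENNReal.Tendsto.const_mul (hlim.const_add _) (Or.inr hB)).const_add _)).add
      (ENNReal.Tendsto.const_mul hlim (Or.inr ENNReal.ofReal_ne_top))
  rw [add_zero, mul_zero, add_zero] at hl
  exact ge_of_tendsto hl (Eventually.of_forall hstep)

end PES

theorem mul_inv_one_sub_add_one {θ : ℝ≥0∞} (hθ : θ < 1) :
    θ * (1 - θ)⁻¹ + 1 = (1 - θ)⁻¹ := by
  have h1 : (1 - θ) * (1 - θ)⁻¹ = 1 :=
    ENNReal.mul_inv_cancel (tsub_pos_of_lt hθ).ne' (by finiteness)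
  calc θ * (1 - θ)⁻¹ + 1 = (θ + (1 - θ)) * (1 - θ)⁻¹ := by rw [add_mul, h1]
    _ = (1 - θ)⁻¹ := by rw [add_tsub_cancel_of_le hθ.le, one_mul]

theorem measurableSet_Gam {d : ℕ} {parts : ℕ → Set (Fin d → ℝ)} (hp : ∀ k, IsOpen (parts k))
    (ε : ℝ) : MeasurableSet (Gam parts ε) :=
  MeasurableSet.iUnion fun k => measurableSet_bLayer (hp k) ε

theorem transferOp_indicator {d : ℕ} (Ω : Set (Fin d → ℝ)) (T : (Fin d → ℝ) → (Fin d → ℝ))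
    (h : (Fin d → ℝ) → ℝ) : transferOp Ω T (Ω.indicator h) = transferOp Ω T h := by
  funext x
  refine tsum_congr fun y => ?_
  rw [indicator_of_mem y.2.1]

theorem iterate_transferOp_indicator_eqOn {d : ℕ} (Ω : Set (Fin d → ℝ))
    (T : (Fin d → ℝ) → (Fin d → ℝ)) (h : (Fin d → ℝ) → ℝ) (n : ℕ) :
    EqOn ((transferOp Ω T)^[n] (Ω.indicator h)) ((transferOp Ω T)^[n] h) Ω := by
  cases n with
  | zero => exact eqOn_indicator
  | succ n =>
    rw [Function.iterate_succ_apply, Function.iterate_succ_apply, transferOp_indicator]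
    exact eqOn_refl _ _

namespace PES

variable {d : ℕ} (S : PES d)

theorem Gam_subset (ε : ℝ) : Gam S.parts ε ⊆ S.Ω :=
  iUnion_subset fun k => (bLayer_subset _ ε).trans (S.parts_subset k)

theorem iterate_transferOp_integrable {h : (Fin d → ℝ) → ℝ} (hh : Integrable h)
    (hsupp : ∀ x, x ∉ Icc (0 : Fin d → ℝ) 1 → h x = 0) (n : ℕ) :
    Integrable ((transferOp S.Ω S.T)^[n] h) ∧
      ∀ x, x ∉ Icc (0 : Fin d → ℝ) 1 → (transferOp S.Ω S.T)^[n] h x = 0 := by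
  induction n with
  | zero => exact ⟨hh, hsupp⟩
  | succ n ih =>
    rw [Function.iterate_succ_apply']
    exact ⟨S.integrable_transferOp ih.1.integrableOn, fun x hx => S.transferOp_eq_zero hx⟩

theorem lintegral_iterate_transferOp_le {h : (Fin d → ℝ) → ℝ} (hh : Integrable h)
    (hsupp : ∀ x, x ∉ Icc (0 : Fin d → ℝ) 1 → h x = 0) (n : ℕ) :
    ∫⁻ x, ‖(transferOp S.Ω S.T)^[n] h x‖ₑ ≤ ∫⁻ x, ‖h x‖ₑ := by
  induction n with
  | zero => rfl
  | succ n ih =>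
    rw [Function.iterate_succ_apply']
    exact (S.lintegral_transferOp_le
      (S.iterate_transferOp_integrable hh hsupp n).1.integrableOn).trans
      ((setLIntegral_le_lintegral _ _).trans ih)

theorem exists_bvNormE_iterate_le (hd : 1 ≤ d) : ∃ M ≠ (∞ : ℝ≥0∞), ∀ h : (Fin d → ℝ) → ℝ,
    Integrable h → (∀ x, x ∉ Icc (0 : Fin d → ℝ) 1 → h x = 0) → ∀ n : ℕ,
    bvNormE ((transferOp S.Ω S.T)^[n] h) ≤ M * bvNormE h := by
  obtain ⟨θ, hθ, B, hB, hLY⟩ := S.exists_lasota_yorke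
  obtain ⟨K, hK⟩ := exists_setLIntegral_le_bvNormE hd
  have hθ' : (1 - θ)⁻¹ ≠ ∞ := ENNReal.inv_ne_top.2 (tsub_pos_of_lt hθ).ne'
  refine ⟨1 + B * K * (1 - θ)⁻¹, by finiteness, fun h hh hsupp n => ?_⟩
  have hL1 : ∫⁻ x, ‖h x‖ₑ ≤ K * bvNormE h := by
    have h1 := hK h (Icc 0 1) hh hsupp
    rw [setLIntegral_eq_of_support_subset] at h1
    · simpa [Real.volume_Icc_pi] using h1
    · intro x hx
      by_contra hxI
      exact hx (by simp [hsupp x hxI])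
  induction n with
  | zero => exact le_mul_of_one_le_left' le_self_add
  | succ n ih =>
    have hn := S.iterate_transferOp_integrable hh hsupp n
    rw [Function.iterate_succ_apply']
    calc _ ≤ θ * bvNormE ((transferOp S.Ω S.T)^[n] h) +
          B * ∫⁻ x, ‖(transferOp S.Ω S.T)^[n] h x‖ₑ := hLY _ hn.1 hn.2
      _ ≤ θ * ((1 + B * K * (1 - θ)⁻¹) * bvNormE h) + B * (K * bvNormE h) := by
          gcongr
          exact (S.lintegral_iterate_transferOp_le hh hsupp n).trans hL1
      _ = (θ + B * K * (θ * (1 - θ)⁻¹ + 1)) * bvNormE h := by ring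
      _ ≤ (1 + B * K * (1 - θ)⁻¹) * bvNormE h := by
          rw [mul_inv_one_sub_add_one hθ]
          gcongr

theorem integrableOn_iterate_transferOp {f : (Fin d → ℝ) → ℝ} (hf : IntegrableOn f S.Ω) (n : ℕ) :
    IntegrableOn ((transferOp S.Ω S.T)^[n] f) S.Ω := by
  induction n with
  | zero => exact hf
  | succ n ih =>
    rw [Function.iterate_succ_apply']
    exact (S.integrable_transferOp ih).integrableOn

theorem integrableOn_tildeOp {f : (Fin d → ℝ) → ℝ} (hf : IntegrableOn f S.Ω) (ν : ℝ) (n : ℕ)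
    (ε : ℝ) : IntegrableOn (tildeOp S.Ω S.T S.parts ν n ε f) S.Ω := by
  induction n generalizing ε with
  | zero => exact hf
  | succ n ih =>
    exact (S.integrable_transferOp
      ((ih (ε * ν)).indicator (measurableSet_Gam S.parts_open ε).compl)).integrableOn

theorem lintegral_iterate_sub_tildeOp_succ_le {f : (Fin d → ℝ) → ℝ} (hf : IntegrableOn f S.Ω)
    (ν : ℝ) (n : ℕ) (ε : ℝ) :
    ∫⁻ x in S.Ω, ‖(transferOp S.Ω S.T)^[n + 1] f x - tildeOp S.Ω S.T S.parts ν (n + 1) ε f x‖ₑ ≤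
      (∫⁻ x in S.Ω, ‖(transferOp S.Ω S.T)^[n] f x - tildeOp S.Ω S.T S.parts ν n (ε * ν) f x‖ₑ) +
        ∫⁻ x in Gam S.parts ε, ‖(transferOp S.Ω S.T)^[n] f x‖ₑ := by
  have hΓ := measurableSet_Gam S.parts_open ε
  have hu := S.integrableOn_iterate_transferOp hf n
  have hv := S.integrableOn_tildeOp hf ν n (ε * ν)
  set u := (transferOp S.Ω S.T)^[n] f with hu_def
  set v := tildeOp S.Ω S.T S.parts ν n (ε * ν) f with hv_def
  have hv' : IntegrableOn ((Gam S.parts ε)ᶜ.indicator v) S.Ω := hv.indicator hΓ.compl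
  rw [Function.iterate_succ_apply', ← hu_def]
  calc ∫⁻ x in S.Ω, ‖transferOp S.Ω S.T u x - transferOp S.Ω S.T ((Gam S.parts ε)ᶜ.indicator v) x‖ₑ
      ≤ ∫⁻ x, ‖transferOp S.Ω S.T u x -
          transferOp S.Ω S.T ((Gam S.parts ε)ᶜ.indicator v) x‖ₑ := setLIntegral_le_lintegral _ _
    _ = ∫⁻ x, ‖transferOp S.Ω S.T (fun x => u x - (Gam S.parts ε)ᶜ.indicator v x) x‖ₑ :=
        lintegral_congr_ae ((S.transferOp_sub_ae hu hv').fun_comp enorm)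
    _ ≤ ∫⁻ x in S.Ω, ‖u x - (Gam S.parts ε)ᶜ.indicator v x‖ₑ :=
        S.lintegral_transferOp_le (Integrable.sub hu hv')
    _ ≤ ∫⁻ x in S.Ω, (‖u x - v x‖ₑ + (Gam S.parts ε).indicator (fun x => ‖u x‖ₑ) x) := by
        refine lintegral_mono fun x => ?_
        by_cases hx : x ∈ Gam S.parts ε <;> simp [hx]
    _ = (∫⁻ x in S.Ω, ‖u x - v x‖ₑ) +
          ∫⁻ x in S.Ω, (Gam S.parts ε).indicator (fun x => ‖u x‖ₑ) x :=
        lintegral_add_left' (Integrable.sub hu hv).aestronglyMeasurable.enorm _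
    _ ≤ _ := add_le_add le_rfl
        ((setLIntegral_le_lintegral _ _).trans (lintegral_indicator_le _ _))

end PES

theorem statement17 {d : ℕ} (hd : 1 ≤ d) (S : PES d) (C α a : ℝ)
    (hC : 0 < C) (hα : α ∈ Set.Ioc (0:ℝ) 1) (ha : 1 ≤ a)
    (hΓ : ∀ ε : ℝ, 0 < ε → volume (Gam S.parts ε) ≤ ENNReal.ofReal (C ^ d * ε ^ α))
    (ν : ℝ) (hν : ν ∈ Set.Ioo (nu0 S.Ω S.T ^ (1 / a)) 1) :
    ∃ C' > (0:ℝ), ∀ f : (Fin d → ℝ) → ℝ, MemBVOn S.Ω f → (∀ x, 0 ≤ f x) →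
      ∀ ε : ℝ, 0 < ε → ∀ n : ℕ,
        (∫⁻ x in S.Ω, ENNReal.ofReal
            |(transferOp S.Ω S.T)^[n] f x - tildeOp S.Ω S.T S.parts ν n ε f x| ∂volume) ≤
          ENNReal.ofReal
            (C' * ε ^ (α / (d:ℝ)) * (1 - ν ^ (α / (d:ℝ)))⁻¹ * bvNormOn S.Ω f) := by
  obtain ⟨M, hM, hbv⟩ := S.exists_bvNormE_iterate_le hd
  obtain ⟨K, hK⟩ := exists_setLIntegral_le_bvNormE hd
  have hd0 : (0 : ℝ) < d := by exact_mod_cast hd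
  have hν0 : 0 < ν := (Real.rpow_nonneg ENNReal.toReal_nonneg _).trans_lt hν.1
  set β : ℝ := α / d with hβ
  have hβ0 : 0 < β := div_pos hα.1 hd0
  have hq0 : 0 ≤ ν ^ β := Real.rpow_nonneg hν0.le _
  have hq1 : ν ^ β < 1 := Real.rpow_lt_one hν0.le hν.2 hβ0
  have hR : K * ENNReal.ofReal C * M ≠ ∞ := by finiteness
  refine ⟨(K * ENNReal.ofReal C * M).toReal + 1, by positivity, fun f hf _ ε hε n => ?_⟩
  have hfΩ : IntegrableOn f S.Ω := (integrable_indicator_iff S.Ω_open.measurableSet).1 hf.1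
  have hsupp : ∀ x, x ∉ Icc (0 : Fin d → ℝ) 1 → S.Ω.indicator f x = 0 := fun x hx =>
    indicator_of_notMem (fun h => hx (S.Ω_subset h)) f
  have hlayer : ∀ n : ℕ, ∀ ε : ℝ, 0 < ε →
      ∫⁻ x in Gam S.parts ε, ‖(transferOp S.Ω S.T)^[n] f x‖ₑ ≤
        K * ENNReal.ofReal C * M * bvNormOnE S.Ω f * ENNReal.ofReal (ε ^ β) := fun n ε hε => by
    have hn := S.iterate_transferOp_integrable hf.1 hsupp n
    have hvol : volume (Gam S.parts ε) ^ (1 / (d : ℝ)) ≤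
        ENNReal.ofReal C * ENNReal.ofReal (ε ^ β) := by
      refine (ENNReal.rpow_le_rpow (hΓ ε hε) (by positivity)).trans (le_of_eq ?_)
      rw [ENNReal.ofReal_rpow_of_nonneg (by positivity) (by positivity),
        Real.mul_rpow (by positivity) (by positivity), ← Real.rpow_mul hε.le, mul_one_div, ← hβ,
        one_div, Real.pow_rpow_inv_natCast hC.le (by omega), ENNReal.ofReal_mul hC.le]
    calc ∫⁻ x in Gam S.parts ε, ‖(transferOp S.Ω S.T)^[n] f x‖ₑ
        = ∫⁻ x in Gam S.parts ε, ‖(transferOp S.Ω S.T)^[n] (S.Ω.indicator f) x‖ₑ :=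
          setLIntegral_congr_fun (measurableSet_Gam S.parts_open ε) fun x hx => by
            simp only [iterate_transferOp_indicator_eqOn S.Ω S.T f n (S.Gam_subset ε hx)]
      _ ≤ K * volume (Gam S.parts ε) ^ (1 / (d : ℝ)) *
            bvNormE ((transferOp S.Ω S.T)^[n] (S.Ω.indicator f)) := hK _ _ hn.1 hn.2
      _ ≤ K * (ENNReal.ofReal C * ENNReal.ofReal (ε ^ β)) * (M * bvNormOnE S.Ω f) := by
          gcongr
          exact hbv _ hf.1 hsupp n
      _ = _ := by ring
  have hmain : ∀ n : ℕ, ∀ ε : ℝ, 0 < ε →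
      ∫⁻ x in S.Ω, ‖(transferOp S.Ω S.T)^[n] f x - tildeOp S.Ω S.T S.parts ν n ε f x‖ₑ ≤
        K * ENNReal.ofReal C * M * bvNormOnE S.Ω f * ENNReal.ofReal (ε ^ β) *
          (1 - ENNReal.ofReal (ν ^ β))⁻¹ := fun n => by
    induction n with
    | zero => intro ε _; simp [tildeOp]
    | succ n ih =>
      intro ε hε
      refine (S.lintegral_iterate_sub_tildeOp_succ_le hfΩ ν n ε).trans
        ((add_le_add (ih (ε * ν) (mul_pos hε hν0)) (hlayer n ε hε)).trans (le_of_eq ?_))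
      rw [Real.mul_rpow hε.le hν0.le, ENNReal.ofReal_mul (Real.rpow_nonneg hε.le _)]
      conv_rhs => rw [← mul_inv_one_sub_add_one (ENNReal.ofReal_lt_one.2 hq1)]
      ring
  simp only [← Real.enorm_eq_ofReal_abs]
  refine (hmain n ε hε).trans ?_
  rw [ENNReal.ofReal_mul (by have := sub_pos.2 hq1; positivity),
    ENNReal.ofReal_mul (by positivity), ENNReal.ofReal_mul (by positivity),
    ENNReal.ofReal_inv_of_pos (sub_pos.2 hq1), ENNReal.ofReal_sub _ hq0, ENNReal.ofReal_one]
  have hV : ENNReal.ofReal (bvNormOn S.Ω f) = bvNormOnE S.Ω f := ENNReal.ofReal_toReal hf.2.ne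
  have hRle : K * ENNReal.ofReal C * M ≤
      ENNReal.ofReal ((K * ENNReal.ofReal C * M).toReal + 1) :=
    (ENNReal.le_ofReal_iff_toReal_le hR (by positivity)).2 (by linarith)
  rw [hV]
  calc _ = K * ENNReal.ofReal C * M * ENNReal.ofReal (ε ^ β) *
        (1 - ENNReal.ofReal (ν ^ β))⁻¹ * bvNormOnE S.Ω f := by ring
    _ ≤ _ := by gcongr

end Liverani
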